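/- arXiv:2201.00186 — 2 statements merged into one kernel-verified Lean document; each statement's English description precedes it below -/
import Mathlib

section
/- For r >= 4, there exists n_1(r) such that for all n > n_1(r), every strongly connected digraph D of order n with out-radius r satisfies |A(D)| <= (n - (r-1))^2 + (r - 3). -/
variable {V : Type*}

/-- `ReachWithin A k u v` means the directed distance from `u` to `v` is at most `k`. -/
def ReachWithin (A : V → V → Prop) : ℕ → V → V → Prop
  | 0, u, v => u = v
  | k+1, u, v => u = v ∨ ∃ w, A u w ∧ ReachWithin A k w v

/-- out-eccentricity of `v` is at most `r`. -/
def outEccLe (A : V → V → Prop) (r : ℕ) (v : V) : Prop :=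
  ∀ u, ReachWithin A r v u

/-- in-eccentricity of `v` is at most `r`. -/
def inEccLe (A : V → V → Prop) (r : ℕ) (v : V) : Prop :=
  ∀ u, ReachWithin A r u v

/-- The out-radius of the digraph `A` equals `r`. -/
def outRadiusIs (A : V → V → Prop) (r : ℕ) : Prop :=
  (∃ v, outEccLe A r v) ∧ ∀ v, ¬ outEccLe A (r - 1) v

/-- A digraph is strongly connected (biconnected) if every vertex reaches every other. -/
def StronglyConnected (A : V → V → Prop) : Prop :=
  ∀ u v, ∃ k, ReachWithin A k u v

/-- Number of arcs of the digraph. -/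
noncomputable def arcCard (A : V → V → Prop) : ℕ :=
  {p : V × V | A p.1 p.2}.ncard

noncomputable def outDeg (A : V → V → Prop) (v : V) : ℕ :=
  {w | A v w}.ncard

noncomputable def inDeg (A : V → V → Prop) (v : V) : ℕ :=
  {w | A w v}.ncard

noncomputable def totalDeg (A : V → V → Prop) (v : V) : ℕ :=
  outDeg A v + inDeg A v

/-- The directed distance from `u` to `v` equals `k`. -/
def DistEq (A : V → V → Prop) (k : ℕ) (u v : V) : Prop :=
  ReachWithin A k u v ∧ ∀ j < k, ¬ ReachWithin A j u v

/-- out-eccentricity as a natural number. -/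
noncomputable def outEcc (A : V → V → Prop) (v : V) : ℕ :=
  sInf {k | outEccLe A k v}

/-- in-eccentricity as a natural number. -/
noncomputable def inEcc (A : V → V → Prop) (v : V) : ℕ :=
  sInf {k | inEccLe A k v}

/-- `P` is a bipartition of the digraph `A`: every arc joins the two classes. -/
def Bipartition (A : V → V → Prop) (P : V → Prop) : Prop :=
  ∀ u v, A u v → (P u ↔ ¬ P v)


section MainProof

open Finset Classical

/-- `x` misses `y`: distinct and no arc. -/
def MissArc (A : V → V → Prop) (x y : V) : Prop := x ≠ y ∧ ¬ A x y

noncomputable def missOut [Fintype V] (A : V → V → Prop) (x : V) : ℕ :=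
  ∑ y, if MissArc A x y then 1 else 0

noncomputable def missIn [Fintype V] (A : V → V → Prop) (x : V) : ℕ :=
  ∑ y, if MissArc A y x then 1 else 0

noncomputable def missAll [Fintype V] (A : V → V → Prop) : ℕ := ∑ x, missOut A x

structure GoodDist (A : V → V → Prop) (r : ℕ) (d : V → V → ℕ) : Prop where
  irr : ∀ x, ¬ A x x
  self : ∀ x, d x x = 0
  zero : ∀ x y, d x y = 0 → x = y
  tri : ∀ x y z, d x z ≤ d x y + d y z
  arc : ∀ x y, A x y → d x y ≤ 1
  one : ∀ x y, d x y ≤ 1 → x = y ∨ A x y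
  pred : ∀ x z k, d x z = k + 1 → ∃ w, d x w = k ∧ A w z
  far : ∀ x, ∃ y, r ≤ d x y

theorem GoodDist.miss_iff {A : V → V → Prop} {r : ℕ} {d : V → V → ℕ} (G : GoodDist A r d)
    (x y : V) : MissArc A x y ↔ 2 ≤ d x y := by
  constructor
  · rintro ⟨h1, h2⟩
    by_contra h
    rcases G.one x y (by omega) with h | h
    · exact h1 h
    · exact h2 h
  · intro h
    refine ⟨?_, ?_⟩
    · rintro rfl
      have := G.self x
      omega
    · intro h'
      have := G.arc x y h'
      omega

theorem GoodDist.path {A : V → V → Prop} {r : ℕ} {d : V → V → ℕ} (G : GoodDist A r d)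
    (v : V) : ∀ k x, d v x = k → ∃ p : ℕ → V, p k = x ∧ (∀ i ≤ k, d v (p i) = i) ∧
      ∀ i < k, A (p i) (p (i+1)) := by
  intro k
  induction k with
  | zero =>
    intro x hx
    refine ⟨fun _ => x, rfl, ?_, ?_⟩
    · intro i hi
      obtain rfl : i = 0 := by omega
      exact hx
    · intro i hi
      omega
  | succ k ih =>
    intro x hx
    obtain ⟨w, hw, hA⟩ := G.pred v x k hx
    obtain ⟨p, hp, h1, h2⟩ := ih w hw
    refine ⟨fun i => if i ≤ k then p i else x, by simp, ?_, ?_⟩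
    · intro i hi
      by_cases h : i ≤ k
      · simp [h, h1 i h]
      · obtain rfl : i = k + 1 := by omega
        simp [hx]
    · intro i hi
      by_cases h : i + 1 ≤ k
      · have h' : i ≤ k := by omega
        simp only [h, h', if_true]
        exact h2 i (by omega)
      · obtain rfl : i = k := by omega
        simp [hp, hA]

theorem GoodDist.path_dist {A : V → V → Prop} {r : ℕ} {d : V → V → ℕ} (G : GoodDist A r d)
    (p : ℕ → V) (k : ℕ) (h : ∀ i < k, A (p i) (p (i+1))) (i : ℕ) :
    ∀ j, i + j ≤ k → d (p i) (p (i + j)) ≤ j := by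
  intro j
  induction j with
  | zero => intro _; simp [G.self]
  | succ j ih =>
    intro hj
    have h1 := ih (by omega)
    have h2 := G.arc _ _ (h (i + j) (by omega))
    have h3 := G.tri (p i) (p (i+j)) (p (i+j+1))
    rw [← add_assoc]
    omega

/-- going back along a geodesic -/
theorem GoodDist.back {A : V → V → Prop} {r : ℕ} {d : V → V → ℕ} (G : GoodDist A r d)
    (v f : V) (i : ℕ) (h : i ≤ d v f) : ∃ z, d v z = i ∧ d z f ≤ d v f - i := by
  obtain ⟨p, h0, h1, h2⟩ := G.path v (d v f) f rfl
  refine ⟨p i, h1 i h, ?_⟩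
  have := G.path_dist p _ h2 i (d v f - i) (by omega)
  rw [show i + (d v f - i) = d v f by omega, h0] at this
  exact this

/-- Layer weights. -/
noncomputable def layerW [Fintype V] (A : V → V → Prop) (d : V → V → ℕ) (v : V) (i : ℕ) : ℕ :=
  ∑ x ∈ univ.filter (fun x => d v x = i),
    ((if MissArc A v x then 1 else 0) + (if MissArc A x v then 1 else 0))

theorem GoodDist.sum_layer [Fintype V] {A : V → V → Prop} {d : V → V → ℕ}
    (v : V) (e : ℕ) (he : ∀ x, d v x ≤ e) :
    missOut A v + missIn A v = ∑ i ∈ range (e+1), layerW A d v i := by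
  unfold missOut missIn layerW
  rw [← Finset.sum_add_distrib]
  symm
  apply Finset.sum_fiberwise_of_maps_to
  intro x _
  have := he x
  simp; omega

theorem GoodDist.layer_one [Fintype V] {A : V → V → Prop} {r : ℕ} {d : V → V → ℕ}
    (G : GoodDist A r d) (v f : V) (i : ℕ) (hi : 2 ≤ i) (h : i ≤ d v f) :
    1 ≤ layerW A d v i := by
  obtain ⟨z, hz, -⟩ := G.back v f i h
  have hm : MissArc A v z := (G.miss_iff v z).2 (by omega)
  unfold layerW
  calc 1 ≤ ((if MissArc A v z then 1 else 0) + (if MissArc A z v then 1 else 0)) := by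
        simp [hm]
    _ ≤ _ := Finset.single_le_sum (f := fun x =>
        ((if MissArc A v x then 1 else 0) + (if MissArc A x v then 1 else 0)))
        (fun _ _ => Nat.zero_le _) (by simp [hz])

theorem GoodDist.card_le_layer [Fintype V] {A : V → V → Prop} {r : ℕ} {d : V → V → ℕ}
    (G : GoodDist A r d) (v : V) (i : ℕ) (hi : 2 ≤ i) :
    (univ.filter (fun x => d v x = i)).card ≤ layerW A d v i := by
  unfold layerW
  rw [Finset.card_eq_sum_ones]
  apply Finset.sum_le_sum
  intro x hx
  simp only [mem_filter, mem_univ, true_and] at hx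
  have hm : MissArc A v x := (G.miss_iff v x).2 (by omega)
  simp [hm]

theorem GoodDist.layer_two [Fintype V] {A : V → V → Prop} {r : ℕ} {d : V → V → ℕ}
    (G : GoodDist A r d) (v f : V) (he : ∀ x, d v x ≤ d v f) (i : ℕ) (hi : 2 ≤ i)
    (hir : i < r) (hie : d v f < i + r) (h : i ≤ d v f) :
    2 ≤ layerW A d v i := by
  by_contra hlt
  have hc := G.card_le_layer v i hi
  obtain ⟨q, hq, -⟩ := G.back v f i h
  have huniq : ∀ x, d v x = i → x = q := by
    intro x hx
    have : (univ.filter (fun x => d v x = i)).card ≤ 1 := by omega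
    exact Finset.card_le_one.1 this x (by simp [hx]) q (by simp [hq])
  have hqm : ¬ MissArc A q v := by
    intro hm
    have hm' : MissArc A v q := (G.miss_iff v q).2 (by omega)
    apply hlt
    unfold layerW
    calc 2 ≤ ((if MissArc A v q then 1 else 0) + (if MissArc A q v then 1 else 0)) := by
          simp [hm, hm']
      _ ≤ _ := Finset.single_le_sum (f := fun x =>
          ((if MissArc A v x then 1 else 0) + (if MissArc A x v then 1 else 0)))
          (fun _ _ => Nat.zero_le _) (by simp [hq])
  rw [G.miss_iff] at hqm
  obtain ⟨g, hg⟩ := G.far q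
  have hge := he g
  by_cases hgi : i ≤ d v g
  · obtain ⟨z, hz, hz2⟩ := G.back v g i hgi
    rw [huniq z hz] at hz2
    omega
  · have := G.tri q v g
    omega

noncomputable def lowB (r e i : ℕ) : ℕ :=
  (if 2 ≤ i then 1 else 0) + (if 2 ≤ i ∧ i < r ∧ e < i + r then 1 else 0)

theorem lowB_sum (r e : ℕ) (hr : 4 ≤ r) (he : r ≤ e) :
    2 * r - 3 ≤ ∑ i ∈ range (e+1), lowB r e i ∧
    (r < e → 2 * r - 2 ≤ ∑ i ∈ range (e+1), lowB r e i) := by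
  have h1 : (range (e+1)).filter (fun i => 2 ≤ i) = Icc 2 e := by
    ext i; simp; omega
  have h2 : (range (e+1)).filter (fun i => 2 ≤ i ∧ i < r ∧ e < i + r)
      = Icc (max 2 (e - r + 1)) (r-1) := by
    ext i; simp; omega
  have h3 : ∑ i ∈ range (e+1), lowB r e i = (e + 1 - 2) + (r - 1 + 1 - max 2 (e-r+1)) := by
    unfold lowB
    rw [Finset.sum_add_distrib, ← Finset.card_filter, ← Finset.card_filter, h1, h2]
    simp
  rw [h3]
  omega

theorem GoodDist.lowB_le [Fintype V] {A : V → V → Prop} {r : ℕ} {d : V → V → ℕ}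
    (G : GoodDist A r d) (v f : V) (he : ∀ x, d v x ≤ d v f) (i : ℕ) (hi : i ≤ d v f) :
    lowB r (d v f) i ≤ layerW A d v i := by
  unfold lowB
  by_cases h : 2 ≤ i
  · have h1 := G.layer_one v f i h hi
    split_ifs with h2
    · exact G.layer_two v f he i h h2.2.1 h2.2.2 hi
    · exact h1
  · simp [h]

theorem GoodDist.exists_max [Fintype V] {A : V → V → Prop} {r : ℕ} {d : V → V → ℕ}
    (G : GoodDist A r d) (v : V) : ∃ f, (∀ x, d v x ≤ d v f) ∧ r ≤ d v f := by
  obtain ⟨f, -, hf⟩ := Finset.exists_max_image univ (d v) ⟨v, mem_univ v⟩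
  obtain ⟨y, hy⟩ := G.far v
  exact ⟨f, fun x => hf x (mem_univ x), hy.trans (hf y (mem_univ y))⟩

theorem GoodDist.deg_ge [Fintype V] {A : V → V → Prop} {r : ℕ} {d : V → V → ℕ} (hr : 4 ≤ r)
    (G : GoodDist A r d) (v : V) : 2 * r - 3 ≤ missOut A v + missIn A v := by
  obtain ⟨f, he, hf⟩ := G.exists_max v
  rw [GoodDist.sum_layer v (d v f) he]
  refine (lowB_sum r (d v f) hr hf).1.trans (Finset.sum_le_sum ?_)
  intro i hi
  exact G.lowB_le v f he i (by simp at hi; omega)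

theorem GoodDist.deg_eq [Fintype V] {A : V → V → Prop} {r : ℕ} {d : V → V → ℕ} (hr : 4 ≤ r)
    (G : GoodDist A r d) (v : V) (h : missOut A v + missIn A v = 2 * r - 3) :
    (∀ x, d v x ≤ r) ∧ (∀ x, d x v ≤ 1) ∧
    (univ.filter (fun x => d v x = r)).card = 1 ∧
    ∀ i, 2 ≤ i → i < r → (univ.filter (fun x => d v x = i)).card = 2 := by
  obtain ⟨f, he, hf⟩ := G.exists_max v
  rw [GoodDist.sum_layer v (d v f) he] at h
  have hle : ∀ i ∈ range (d v f + 1), lowB r (d v f) i ≤ layerW A d v i := by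
    intro i hi
    exact G.lowB_le v f he i (by simp at hi; omega)
  have hS := Finset.sum_le_sum hle
  obtain ⟨hs1, hs2⟩ := lowB_sum r (d v f) hr hf
  have hfr : d v f = r := by
    by_contra hne
    have := hs2 (by omega)
    omega
  rw [hfr] at he hle hS hs1 h
  have hEq : ∀ i ∈ range (r+1), lowB r r i = layerW A d v i :=
    (Finset.sum_eq_sum_iff_of_le hle).1 (by omega)
  have hEq' : ∀ i ≤ r, layerW A d v i = lowB r r i := fun i hi =>
    (hEq i (by simp; omega)).symm
  have key : ∀ i ≤ r, layerW A d v i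
      = (if 2 ≤ i then (univ.filter (fun x => d v x = i)).card else 0)
        + ((univ.filter (fun x => d v x = i)).filter (fun x => MissArc A x v)).card := by
    intro i _
    unfold layerW
    rw [Finset.sum_add_distrib, ← Finset.card_filter, ← Finset.card_filter]
    congr 1
    by_cases h2 : 2 ≤ i
    · simp only [h2, if_true]
      congr 1
      apply Finset.filter_true_of_mem
      intro x hx
      simp at hx
      rw [G.miss_iff]; omega
    · simp only [h2, if_false]
      rw [Finset.card_eq_zero]
      apply Finset.filter_false_of_mem
      intro x hx
      simp at hx
      rw [G.miss_iff]; omega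
  have hpos : ∀ i ≤ r, 1 ≤ (univ.filter (fun x => d v x = i)).card := by
    intro i hi
    obtain ⟨z, hz, -⟩ := G.back v f i (by omega)
    exact Finset.card_pos.2 ⟨z, by simp [hz]⟩
  -- no missing arcs if the layer is not a singleton
  have hnomiss : ∀ x, ¬ (2 ≤ d v x ∧ d v x < r ∧ (univ.filter (fun z => d v z = d v x)).card = 1)
      → d x v ≤ 1 := by
    intro x hx
    by_contra hc
    have hm : MissArc A x v := (G.miss_iff x v).2 (by omega)
    have h1 := key (d v x) (he x)
    rw [hEq' _ (he x)] at h1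
    have h2 : 1 ≤ ((univ.filter (fun z => d v z = d v x)).filter (fun x => MissArc A x v)).card :=
      Finset.card_pos.2 ⟨x, by simp [hm]⟩
    have h3 := hpos _ (he x)
    have h4 := he x
    unfold lowB at h1
    by_cases h5 : 2 ≤ d v x
    · by_cases h6 : d v x < r
      · have : r < d v x + r := by omega
        simp only [h5, h6, this, if_true, and_self] at h1
        apply hx
        refine ⟨h5, h6, by omega⟩
      · simp only [h5, h6, if_true, and_false, false_and, if_false] at h1
        omega
    · simp only [h5, if_false, false_and] at h1
      omega
  have hns : ∀ i, 2 ≤ i → i < r → (univ.filter (fun x => d v x = i)).card ≠ 1 := by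
    intro i
    induction i using Nat.strong_induction_on with
    | _ i ih =>
    intro hi hir hcard
    obtain ⟨q, hq⟩ := Finset.card_eq_one.1 hcard
    have hq' : ∀ x, d v x = i ↔ x = q := by
      intro x
      have := congrArg (fun s => x ∈ s) hq
      simpa using this
    have hqi : d v q = i := (hq' q).2 rfl
    obtain ⟨w, hw, hwA⟩ := G.pred v q (i-1) (by omega)
    have hwv : d w v ≤ 1 := by
      apply hnomiss
      rintro ⟨h1, h2, h3⟩
      rw [hw] at h1 h2 h3
      exact ih (i-1) (by omega) h1 h2 h3
    obtain ⟨g, hg⟩ := G.far w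
    have t1 := G.tri w v g
    obtain ⟨z, hz, hz2⟩ := G.back v g i (by omega)
    rw [(hq' z).1 hz] at hz2
    have t2 := G.tri w q g
    have t3 := G.arc _ _ hwA
    have t4 := he g
    omega
  refine ⟨he, ?_, ?_, ?_⟩
  · intro x
    apply hnomiss
    rintro ⟨h1, h2, h3⟩
    exact hns _ h1 h2 h3
  · have h1 := key r le_rfl
    rw [hEq' _ le_rfl] at h1
    have h3 := hpos r le_rfl
    have : 2 ≤ r := by omega
    simp only [lowB, this, if_true, lt_irrefl, false_and, and_false, if_false] at h1
    omega
  · intro i hi hir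
    have h1 := key i hir.le
    rw [hEq' _ hir.le] at h1
    have h3 := hpos i hir.le
    have h4 := hns i hi hir
    have : r < i + r := by omega
    simp only [lowB, hi, hir, this, if_true, and_self] at h1
    omega

theorem missOut_ge_card [Fintype V] {A : V → V → Prop} (x : V) (S : Finset V)
    (h : ∀ z ∈ S, MissArc A x z) : S.card ≤ missOut A x := by
  unfold missOut
  rw [← Finset.card_filter]
  apply Finset.card_le_card
  intro z hz
  simp [h z hz]

/-- Two strands below a vertex `v`. -/
structure Strands [Fintype V] (A : V → V → Prop) (r : ℕ) (d : V → V → ℕ) (v : V)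
    (a b : ℕ → V) : Prop where
  ecc : ∀ x, d v x ≤ r
  dom : ∀ x, d x v ≤ 1
  da : ∀ i ≤ r, d v (a i) = i
  db : ∀ i ≤ r - 1, d v (b i) = i
  aa : ∀ i < r, A (a i) (a (i+1))
  bb : ∀ i < r - 1, A (b i) (b (i+1))
  ne : ∀ i, 2 ≤ i → i < r → a i ≠ b i
  layer : ∀ i, 2 ≤ i → i < r → ∀ x, d v x = i → x = a i ∨ x = b i
  top : ∀ x, d v x = r → x = a r

theorem GoodDist.exists_strands [Fintype V] {A : V → V → Prop} {r : ℕ} {d : V → V → ℕ}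
    (hr : 4 ≤ r) (G : GoodDist A r d) (v : V) (h : missOut A v + missIn A v = 2 * r - 3) :
    ∃ a b, Strands A r d v a b := by
  obtain ⟨he, hdom, h1, h2⟩ := G.deg_eq hr v h
  obtain ⟨y, hy⟩ := Finset.card_eq_one.1 h1
  have hy' : ∀ x, d v x = r ↔ x = y := by
    intro x
    have := congrArg (fun s => x ∈ s) hy
    simpa using this
  obtain ⟨a, ha0, ha1, ha2⟩ := G.path v r y ((hy' y).2 rfl)
  have hlay : ∀ i, 2 ≤ i → i < r → ∀ p q, d v p = i → d v q = i → p ≠ q →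
      ∀ x, d v x = i → x = p ∨ x = q := by
    intro i hi hir p q hp hq hpq x hx
    by_contra hc
    push Not at hc
    have : ({x, p, q} : Finset V) ⊆ univ.filter (fun x => d v x = i) := by
      intro z hz
      simp only [mem_insert, mem_singleton] at hz
      rcases hz with rfl | rfl | rfl <;> simp [*]
    have hc3 := Finset.card_le_card this
    rw [h2 i hi hir, Finset.card_eq_three.2 ⟨x, p, q, hc.1, hc.2, hpq, rfl⟩] at hc3
    omega
  have hex : ∃ w, d v w = r - 1 ∧ w ≠ a (r-1) := by
    obtain ⟨s, t, hst, hs⟩ := Finset.card_eq_two.1 (h2 (r-1) (by omega) (by omega))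
    have h3 : ∀ x, d v x = r-1 ↔ x = s ∨ x = t := by
      intro x
      have := congrArg (fun s => x ∈ s) hs
      simpa using this
    by_cases hsa : s = a (r-1)
    · exact ⟨t, (h3 t).2 (Or.inr rfl), fun h => hst (hsa.trans h.symm)⟩
    · exact ⟨s, (h3 s).2 (Or.inl rfl), hsa⟩
  obtain ⟨w, hw, hwa⟩ := hex
  obtain ⟨b, hb0, hb1, hb2⟩ := G.path v (r-1) w hw
  have hne : ∀ i, 2 ≤ i → i < r → a i ≠ b i := by
    intro i hi hir hab
    obtain ⟨g, hg⟩ := G.far (a i)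
    have t1 := G.tri (a i) v g
    have t2 := hdom (a i)
    have p1 := G.path_dist a r ha2 i (r - i) (by omega)
    have p2 := G.path_dist a r ha2 i (r - 1 - i) (by omega)
    have p3 := G.path_dist b (r-1) hb2 i (r - 1 - i) (by omega)
    rw [show i + (r - i) = r by omega] at p1
    rw [show i + (r - 1 - i) = r - 1 by omega] at p2 p3
    rw [← hab] at p3
    by_cases hgr : d v g = r
    · have : g = a r := by rw [(hy' g).1 hgr, ha0]
      rw [this] at hg
      omega
    · have := he g
      rcases hlay (r-1) (by omega) (by omega) (a (r-1)) w (ha1 _ (by omega)) hw hwa.symm g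
        (by omega) with h' | h'
      · rw [h'] at hg; omega
      · rw [h', ← hb0] at hg; omega
  refine ⟨a, b, he, hdom, ha1, hb1, ha2, hb2, hne, ?_, ?_⟩
  · intro i hi hir
    exact hlay i hi hir _ _ (ha1 i (by omega)) (hb1 i (by omega)) (hne i hi hir)
  · intro x hx
    rw [(hy' x).1 hx, ha0]

section
variable [Fintype V] {A : V → V → Prop} {r : ℕ} {d : V → V → ℕ} {v : V} {a b : ℕ → V}

theorem Strands.cnt (S : Strands A r d v a b) (x : V) (W : Finset V)
    (J K : Finset ℕ) (hW : ∀ z ∈ W, d v z = 1 ∧ MissArc A x z)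
    (hJ : ∀ j ∈ J, 2 ≤ j ∧ j ≤ r ∧ MissArc A x (a j))
    (hK : ∀ j ∈ K, 2 ≤ j ∧ j < r ∧ MissArc A x (b j)) :
    W.card + J.card + K.card ≤ missOut A x := by
  have cJ : (J.image a).card = J.card := by
    apply Finset.card_image_of_injOn
    intro i hi j hj hij
    have h1 := S.da i (hJ i hi).2.1
    have h2 := S.da j (hJ j hj).2.1
    rw [hij] at h1
    omega
  have cK : (K.image b).card = K.card := by
    apply Finset.card_image_of_injOn
    intro i hi j hj hij
    have h1 := S.db i (by have := hK i hi; omega)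
    have h2 := S.db j (by have := hK j hj; omega)
    rw [hij] at h1
    omega
  have d1 : Disjoint W (J.image a) := by
    rw [Finset.disjoint_left]
    intro z hz hz2
    obtain ⟨j, hj, rfl⟩ := Finset.mem_image.1 hz2
    have h1 := (hW _ hz).1
    have h2 := hJ j hj
    rw [S.da j h2.2.1] at h1
    omega
  have d2 : Disjoint (W ∪ J.image a) (K.image b) := by
    rw [Finset.disjoint_left]
    intro z hz hz2
    obtain ⟨k, hk, rfl⟩ := Finset.mem_image.1 hz2
    have h2 := hK k hk
    have h3 := S.db k (by omega)
    rcases Finset.mem_union.1 hz with hz | hz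
    · have h1 := (hW _ hz).1
      omega
    · obtain ⟨j, hj, hjk⟩ := Finset.mem_image.1 hz
      have h4 := hJ j hj
      have h5 := S.da j h4.2.1
      rw [hjk] at h5
      have : j = k := by omega
      subst this
      exact S.ne j h2.1 h2.2.1 hjk
  rw [← cJ, ← cK, ← Finset.card_union_of_disjoint d1, ← Finset.card_union_of_disjoint d2]
  apply missOut_ge_card
  intro z hz
  rcases Finset.mem_union.1 hz with hz | hz
  · rcases Finset.mem_union.1 hz with hz | hz
    · exact (hW z hz).2
    · obtain ⟨j, hj, rfl⟩ := Finset.mem_image.1 hz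
      exact (hJ j hj).2.2
  · obtain ⟨j, hj, rfl⟩ := Finset.mem_image.1 hz
    exact (hK j hj).2.2

theorem GoodDist.miss_far (G : GoodDist A r d) {x z t : V} {k : ℕ} (h1 : k + 2 ≤ d x t)
    (h2 : d z t ≤ k) : MissArc A x z := by
  rw [G.miss_iff]
  have := G.tri x z t
  omega

theorem GoodDist.miss_layer (G : GoodDist A r d) {x z : V} (h : d v x + 2 ≤ d v z) :
    MissArc A x z := by
  rw [G.miss_iff]
  have := G.tri v x z
  omega

theorem Strands.distA (G : GoodDist A r d) (S : Strands A r d v a b) (i j : ℕ) (hij : i ≤ j)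
    (hj : j ≤ r) : d (a i) (a j) ≤ j - i := by
  have := G.path_dist a r S.aa i (j - i) (by omega)
  rwa [show i + (j - i) = j by omega] at this

theorem Strands.distB (G : GoodDist A r d) (S : Strands A r d v a b) (i j : ℕ) (hij : i ≤ j)
    (hj : j ≤ r - 1) : d (b i) (b j) ≤ j - i := by
  have := G.path_dist b (r-1) S.bb i (j - i) (by omega)
  rwa [show i + (j - i) = j by omega] at this

theorem Strands.far3 (hr : 4 ≤ r) (G : GoodDist A r d) (S : Strands A r d v a b) (x : V) :
    r ≤ d x (a (r-1)) ∨ r ≤ d x (b (r-1)) ∨ r ≤ d x (a r) := by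
  obtain ⟨g, hg⟩ := G.far x
  have t1 := G.tri x v g
  have t2 := S.dom x
  by_cases hgr : d v g = r
  · rw [S.top g hgr] at hg
    exact Or.inr (Or.inr hg)
  · have := S.ecc g
    rcases S.layer (r-1) (by omega) (by omega) g (by omega) with h | h
    · rw [h] at hg; exact Or.inl hg
    · rw [h] at hg; exact Or.inr (Or.inl hg)

theorem Strands.farB (hr : 4 ≤ r) (G : GoodDist A r d) (S : Strands A r d v a b) (x : V)
    (h : d x (a (r-1)) ≤ r - 2) : r ≤ d x (b (r-1)) := by
  have h1 := G.tri x (a (r-1)) (a r)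
  have h2 := S.distA G (r-1) r (by omega) le_rfl
  rcases S.far3 hr G x with h | h | h <;> omega

theorem Strands.missB (hr : 4 ≤ r) (G : GoodDist A r d) (S : Strands A r d v a b) (x : V)
    (h : r ≤ d x (b (r-1))) (j : ℕ) (h1 : 1 ≤ j) (hj : j < r) : MissArc A x (b j) := by
  have := S.distB G j (r-1) (by omega) le_rfl
  exact G.miss_far (k := r - 2) (by omega) (by omega : d (b j) (b (r-1)) ≤ r - 2)

/-- the vertices of the first layer that dominate `b 2` -/
noncomputable def setU (A : V → V → Prop) (d : V → V → ℕ) (v : V) (b : ℕ → V) : Finset V :=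
  univ.filter (fun x => d v x = 1 ∧ A x (b 2))

theorem Strands.distU (hr : 4 ≤ r) (G : GoodDist A r d) (S : Strands A r d v a b) (z : V)
    (h : A z (b 2)) : d z (b (r-1)) ≤ r - 2 := by
  have h1 := S.distB G 2 (r-1) (by omega) le_rfl
  have h2 := G.tri z (b 2) (b (r-1))
  have h3 := G.arc _ _ h
  omega

theorem Strands.missU (hr : 4 ≤ r) (G : GoodDist A r d) (S : Strands A r d v a b) (x : V)
    (h : r ≤ d x (b (r-1))) : ∀ z ∈ setU A d v b, d v z = 1 ∧ MissArc A x z := by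
  intro z hz
  simp only [setU, mem_filter, mem_univ, true_and] at hz
  refine ⟨hz.1, ?_⟩
  have := S.distU hr G z hz.2
  exact G.miss_far (k := r - 2) (by omega) this

theorem Strands.cardU (hr : 4 ≤ r) (S : Strands A r d v a b) :
    1 ≤ (setU A d v b).card := by
  apply Finset.card_pos.2
  refine ⟨b 1, ?_⟩
  simp only [setU, mem_filter, mem_univ, true_and]
  exact ⟨S.db 1 (by omega), S.bb 1 (by omega)⟩

theorem Strands.outA (hr : 4 ≤ r) (G : GoodDist A r d) (S : Strands A r d v a b) (i : ℕ)
    (hi : 2 ≤ i) (hir : i < r) :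
    (setU A d v b).card + (r - 1 - i) + (r - 2) ≤ missOut A (a i) := by
  have hB := S.farB hr G (a i) (by
    have := S.distA G i (r-1) (by omega) (by omega)
    omega)
  have := S.cnt (a i) (setU A d v b) (Icc (i+2) r) (Icc 2 (r-1)) (S.missU hr G _ hB) (by
    intro j hj
    rw [mem_Icc] at hj
    refine ⟨by omega, hj.2, G.miss_layer (v := v) ?_⟩
    rw [S.da i (by omega), S.da j hj.2]
    omega) (by
    intro j hj
    rw [mem_Icc] at hj
    exact ⟨hj.1, by omega, S.missB hr G _ hB j (by omega) (by omega)⟩)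
  simp only [Nat.card_Icc] at this
  omega

theorem Strands.outB (hr : 4 ≤ r) (G : GoodDist A r d) (S : Strands A r d v a b) (x : V) (i : ℕ)
    (hi : 1 ≤ i) (hir : i < r) (hxi : d v x = i) (hx : d x (b (r-1)) ≤ r - 2) :
    (r - 1) + (r - 2 - i) ≤ missOut A x := by
  have hK : ∀ j ∈ Icc (i+2) (r-1), 2 ≤ j ∧ j < r ∧ MissArc A x (b j) := by
    intro j hj
    rw [mem_Icc] at hj
    refine ⟨by omega, by omega, G.miss_layer (v := v) ?_⟩
    rw [S.db j (by omega)]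
    omega
  rcases S.far3 hr G x with h | h | h
  · have hm : ∀ j, 1 ≤ j → j < r → MissArc A x (a j) := by
      intro j h1 h2
      have := S.distA G j (r-1) (by omega) (by omega)
      exact G.miss_far (k := r - 2) (by omega) (by omega : d (a j) (a (r-1)) ≤ r - 2)
    have := S.cnt x {a 1} (Icc 2 (r-1)) (Icc (i+2) (r-1)) (by
      intro z hz
      rw [mem_singleton] at hz
      subst hz
      exact ⟨S.da 1 (by omega), hm 1 le_rfl (by omega)⟩) (by
      intro j hj
      rw [mem_Icc] at hj
      exact ⟨hj.1, by omega, hm j (by omega) (by omega)⟩) hK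
    simp only [Nat.card_Icc, card_singleton] at this
    omega
  · omega
  · have := S.cnt x ∅ (Icc 2 r) (Icc (i+2) (r-1)) (by simp) (by
      intro j hj
      rw [mem_Icc] at hj
      refine ⟨hj.1, by omega, ?_⟩
      have := S.distA G j r (by omega) (by omega)
      exact G.miss_far (k := r - 2) (by omega) (by omega : d (a j) (a r) ≤ r - 2)) hK
    simp only [Nat.card_Icc, card_empty] at this
    omega

theorem Strands.outTop (hr : 4 ≤ r) (G : GoodDist A r d) (S : Strands A r d v a b) :
    r - 1 ≤ missOut A (a r) := by
  rcases S.far3 hr G (a r) with h | h | h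
  · have hm : ∀ j, 1 ≤ j → j < r → MissArc A (a r) (a j) := by
      intro j h1 h2
      have := S.distA G j (r-1) (by omega) (by omega)
      exact G.miss_far (k := r - 2) (by omega) (by omega : d (a j) (a (r-1)) ≤ r - 2)
    have := S.cnt (a r) {a 1} (Icc 2 (r-1)) ∅ (by
      intro z hz
      rw [mem_singleton] at hz
      subst hz
      exact ⟨S.da 1 (by omega), hm 1 le_rfl (by omega)⟩) (by
      intro j hj
      rw [mem_Icc] at hj
      exact ⟨hj.1, by omega, hm j (by omega) (by omega)⟩) (by simp)
    simp only [Nat.card_Icc, card_singleton] at this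
    omega
  · have := S.cnt (a r) (setU A d v b) ∅ (Icc 2 (r-1)) (S.missU hr G _ h) (by simp) (by
      intro j hj
      rw [mem_Icc] at hj
      exact ⟨hj.1, by omega, S.missB hr G _ h j (by omega) (by omega)⟩)
    have h2 := S.cardU hr
    simp only [Nat.card_Icc] at this
    omega
  · rw [G.self] at h
    omega

theorem Strands.outOne (hr : 4 ≤ r) (G : GoodDist A r d) (S : Strands A r d v a b) (x : V)
    (hx : d v x = 1) (hxb : ¬ A x (b 2)) : 2 * r - 3 ≤ missOut A x := by
  have hJ : ∀ j, 3 ≤ j → j ≤ r → MissArc A x (a j) := by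
    intro j h1 h2
    apply G.miss_layer (v := v)
    rw [S.da j h2]
    omega
  by_cases hA : A x (a 2)
  · have hB := S.farB hr G x (by
      have h1 := S.distA G 2 (r-1) (by omega) (by omega)
      have h2 := G.tri x (a 2) (a (r-1))
      have h3 := G.arc _ _ hA
      omega)
    have := S.cnt x (setU A d v b) (Icc 3 r) (Icc 2 (r-1)) (S.missU hr G _ hB) (by
      intro j hj
      rw [mem_Icc] at hj
      exact ⟨by omega, hj.2, hJ j hj.1 hj.2⟩) (by
      intro j hj
      rw [mem_Icc] at hj
      exact ⟨hj.1, by omega, S.missB hr G _ hB j (by omega) (by omega)⟩)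
    have h2 := S.cardU hr
    simp only [Nat.card_Icc] at this
    omega
  · have hxn : ∀ z, d v z = 2 → x ≠ z := by
      rintro z hz rfl
      omega
    have := S.cnt x ∅ (Icc 2 r) (Icc 2 (r-1)) (by simp) (by
      intro j hj
      rw [mem_Icc] at hj
      refine ⟨hj.1, hj.2, ?_⟩
      by_cases h : j = 2
      · subst h
        exact ⟨hxn _ (S.da 2 (by omega)), hA⟩
      · exact hJ j (by omega) hj.2) (by
      intro j hj
      rw [mem_Icc] at hj
      refine ⟨hj.1, by omega, ?_⟩
      by_cases h : j = 2
      · subst h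
        exact ⟨hxn _ (S.db 2 (by omega)), hxb⟩
      · apply G.miss_layer (v := v)
        rw [S.db j (by omega)]
        omega)
    simp only [Nat.card_Icc, card_empty] at this
    omega

/-- deficit of a layer -/
noncomputable def defL (A : V → V → Prop) (r : ℕ) (d : V → V → ℕ) (v : V) (i : ℕ) : ℤ :=
  ∑ x ∈ univ.filter (fun x => d v x = i), ((2 * r - 3 : ℤ) - missOut A x)

theorem Strands.def_mid (S : Strands A r d v a b) (i : ℕ) (hi : 2 ≤ i)
    (hir : i < r) : defL A r d v i
      = ((2 * r - 3 : ℤ) - missOut A (a i)) + ((2 * r - 3 : ℤ) - missOut A (b i)) := by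
  have : univ.filter (fun x => d v x = i) = {a i, b i} := by
    ext x
    simp only [mem_filter, mem_univ, true_and, mem_insert, mem_singleton]
    constructor
    · exact S.layer i hi hir x
    · rintro (rfl | rfl)
      · exact S.da i (by omega)
      · exact S.db i (by omega)
  unfold defL
  rw [this, Finset.sum_pair (S.ne i hi hir)]

theorem Strands.def_top (S : Strands A r d v a b) :
    defL A r d v r = ((2 * r - 3 : ℤ) - missOut A (a r)) := by
  have : univ.filter (fun x => d v x = r) = {a r} := by
    ext x
    simp only [mem_filter, mem_univ, true_and, mem_singleton]
    constructor
    · exact S.top x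
    · rintro rfl
      exact S.da r le_rfl
  unfold defL
  rw [this, Finset.sum_singleton]

theorem Strands.def_one (hr : 4 ≤ r) (G : GoodDist A r d) (S : Strands A r d v a b) :
    defL A r d v 1 ≤ (setU A d v b).card := by
  have : (((setU A d v b).card : ℕ) : ℤ)
      = ∑ x ∈ univ.filter (fun x => d v x = 1), if A x (b 2) then (1 : ℤ) else 0 := by
    rw [← Finset.sum_filter, Finset.filter_filter]
    simp [setU]
  rw [this]
  unfold defL
  apply Finset.sum_le_sum
  intro x hx
  simp only [mem_filter, mem_univ, true_and] at hx
  split_ifs with h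
  · have := S.outB hr G x 1 le_rfl (by omega) hx (S.distU hr G x h)
    omega
  · have := S.outOne hr G x hx h
    omega

theorem Strands.total (hr : 4 ≤ r) (G : GoodDist A r d) (S : Strands A r d v a b)
    (hv : 2 * r - 3 ≤ missOut A v) :
    (2 * r - 3) * Fintype.card V ≤ missAll A + (r - 2) * (r + 1) := by
  have hsum : ∑ x, ((2 * r - 3 : ℤ) - missOut A x) = ∑ i ∈ range (r+1), defL A r d v i := by
    unfold defL
    symm
    apply Finset.sum_fiberwise_of_maps_to
    intro x _
    have := S.ecc x
    simp; omega
  have h0 : defL A r d v 0 ≤ 0 := by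
    have : univ.filter (fun x => d v x = 0) = {v} := by
      ext x
      simp only [mem_filter, mem_univ, true_and, mem_singleton]
      constructor
      · intro h; exact (G.zero _ _ h).symm
      · rintro rfl
        exact G.self x
    unfold defL
    rw [this, Finset.sum_singleton]
    omega
  have h1 := S.def_one hr G
  have hb : ∀ i, 2 ≤ i → i < r → (r - 1) + (r - 2 - i) ≤ missOut A (b i) := by
    intro i hi hir
    apply S.outB hr G (b i) i (by omega) hir (S.db i (by omega))
    have := S.distB G i (r-1) (by omega) le_rfl
    omega
  have hmid : ∀ m, m + 2 ≤ r - 2 → ∑ i ∈ range (m + 3), defL A r d v i ≤ ((m:ℤ) + 2)^2 := by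
    intro m
    induction m with
    | zero =>
      intro _
      rw [Finset.sum_range_succ, Finset.sum_range_succ, Finset.sum_range_succ,
        Finset.sum_range_zero, S.def_mid 2 le_rfl (by omega)]
      have e1 := S.outA hr G 2 le_rfl (by omega)
      have e2 := hb 2 le_rfl (by omega)
      norm_num
      omega
    | succ m ih =>
      intro hm
      rw [Finset.sum_range_succ, S.def_mid (m+3) (by omega) (by omega)]
      have e0 := ih (by omega)
      have e1 := S.outA hr G (m+3) (by omega) (by omega)
      have e2 := hb (m+3) (by omega) (by omega)
      have e3 := S.cardU hr
      have e4 : (((m + 1 : ℕ) : ℤ) + 2)^2 = ((m:ℤ)+2)^2 + (2 * m + 5) := by push_cast; ring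
      rw [e4]
      omega
  obtain ⟨m, rfl⟩ : ∃ m, r = m + 4 := ⟨r - 4, by omega⟩
  have hm := hmid m (by omega)
  rw [Finset.sum_range_succ, Finset.sum_range_succ, S.def_top,
    S.def_mid (m+3) (by omega) (by omega)] at hsum
  have e1 := S.outA hr G (m+3) (by omega) (by omega)
  have e2 := hb (m+3) (by omega) (by omega)
  have e3 := S.cardU hr
  have e5 := S.outTop hr G
  rw [Finset.sum_sub_distrib] at hsum
  simp only [Finset.sum_const, card_univ, nsmul_eq_mul] at hsum
  have hM : ((missAll A : ℕ) : ℤ) = ∑ x, (missOut A x : ℤ) := by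
    unfold missAll; push_cast; rfl
  rw [← hM] at hsum
  zify [show 3 ≤ 2 * (m+4) by omega, show 2 ≤ m + 4 by omega]
  push_cast at hsum ⊢
  have e6 : (Fintype.card V : ℤ) * (2 * (m + 4) - 3) - missAll A
      ≤ ((m:ℤ)+2)^2 + 3 * m + 6 := by omega
  nlinarith [e6]

end

theorem reach_mono {A : V → V → Prop} : ∀ k (u v : V), ReachWithin A k u v →
    ReachWithin A (k+1) u v := by
  intro k
  induction k with
  | zero => intro u v h; exact Or.inl h
  | succ k ih =>
    rintro u v (h | ⟨w, h1, h2⟩)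
    · exact Or.inl h
    · exact Or.inr ⟨w, h1, ih w v h2⟩

theorem reach_le {A : V → V → Prop} {k l : ℕ} (h : k ≤ l) (u v : V)
    (h1 : ReachWithin A k u v) : ReachWithin A l u v := by
  induction h with
  | refl => exact h1
  | step _ ih => exact reach_mono _ _ _ ih

theorem reach_trans {A : V → V → Prop} : ∀ k l (u v w : V), ReachWithin A k u v →
    ReachWithin A l v w → ReachWithin A (k+l) u w := by
  intro k
  induction k with
  | zero =>
    intro l u v w h1 h2
    obtain rfl : u = v := h1
    simpa using h2
  | succ k ih =>
    rintro l u v w (h | ⟨z, h1, h2⟩) h3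
    · subst h
      exact reach_le (by omega) _ _ h3
    · rw [show k + 1 + l = (k + l) + 1 by omega]
      exact Or.inr ⟨z, h1, ih l z v w h2 h3⟩

theorem reach_arc {A : V → V → Prop} (u v : V) (h : A u v) : ReachWithin A 1 u v :=
  Or.inr ⟨v, h, rfl⟩

theorem reach_last {A : V → V → Prop} : ∀ k (u v : V), ReachWithin A (k+1) u v →
    ReachWithin A k u v ∨ ∃ w, ReachWithin A k u w ∧ A w v := by
  intro k
  induction k with
  | zero =>
    rintro u v (h | ⟨w, h1, h2⟩)
    · exact Or.inl h
    · obtain rfl : w = v := h2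
      exact Or.inr ⟨u, rfl, h1⟩
  | succ k ih =>
    rintro u v (h | ⟨w, h1, h2⟩)
    · exact Or.inl (Or.inl h)
    · rcases ih w v h2 with h | ⟨z, h3, h4⟩
      · exact Or.inl (Or.inr ⟨w, h1, h⟩)
      · exact Or.inr ⟨z, Or.inr ⟨w, h1, h3⟩, h4⟩

theorem exists_goodDist {A : V → V → Prop} {r : ℕ} (hr : 4 ≤ r) (hirr : ∀ x, ¬ A x x)
    (hsc : StronglyConnected A) (hfar : ∀ v, ¬ outEccLe A (r - 1) v) :
    ∃ d, GoodDist A r d := by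
  refine ⟨fun u v => Nat.find (hsc u v), hirr, ?_, ?_, ?_, ?_, ?_, ?_, ?_⟩
  · intro x
    have : Nat.find (hsc x x) ≤ 0 := Nat.find_min' _ rfl
    simpa using this
  · intro x y h
    have := Nat.find_spec (hsc x y)
    have h' : Nat.find (hsc x y) = 0 := h
    rw [h'] at this
    exact this
  · intro x y z
    exact Nat.find_min' _ (reach_trans _ _ _ _ _ (Nat.find_spec (hsc x y))
      (Nat.find_spec (hsc y z)))
  · intro x y h
    exact Nat.find_min' _ (reach_arc _ _ h)
  · intro x y h
    have := reach_le h _ _ (Nat.find_spec (hsc x y))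
    rcases this with h | ⟨w, h1, h2⟩
    · exact Or.inl h
    · obtain rfl : w = y := h2
      exact Or.inr h1
  · intro x z k h
    have h0 : Nat.find (hsc x z) = k + 1 := h
    have h1 := Nat.find_spec (hsc x z)
    rw [h0] at h1
    rcases reach_last _ _ _ h1 with h2 | ⟨w, h2, h3⟩
    · have : Nat.find (hsc x z) ≤ k := Nat.find_min' _ h2
      omega
    · refine ⟨w, ?_, h3⟩
      have e1 : Nat.find (hsc x w) ≤ k := Nat.find_min' _ h2
      have e2 : Nat.find (hsc x z) ≤ Nat.find (hsc x w) + 1 :=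
        Nat.find_min' _ (reach_trans _ _ _ _ _ (Nat.find_spec (hsc x w)) (reach_arc _ _ h3))
      show Nat.find (hsc x w) = k
      omega
  · intro x
    have := hfar x
    unfold outEccLe at this
    push Not at this
    obtain ⟨y, hy⟩ := this
    refine ⟨y, ?_⟩
    by_contra hc
    have hc' : Nat.find (hsc x y) ≤ r - 1 := by
      have : ¬ r ≤ Nat.find (hsc x y) := hc
      omega
    exact hy (reach_le hc' _ _ (Nat.find_spec (hsc x y)))

theorem reach_iff_rtg {A : V → V → Prop} (u v : V) :
    (∃ k, ReachWithin A k u v) ↔ Relation.ReflTransGen A u v := by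
  constructor
  · rintro ⟨k, h⟩
    induction k generalizing u with
    | zero => obtain rfl : u = v := h; exact .refl
    | succ k ih =>
      rcases h with h | ⟨w, h1, h2⟩
      · subst h; exact .refl
      · exact .head h1 (ih w h2)
  · intro h
    induction h using Relation.ReflTransGen.head_induction_on with
    | refl => exact ⟨0, rfl⟩
    | head h1 _ ih =>
      obtain ⟨k, hk⟩ := ih
      exact ⟨k+1, Or.inr ⟨_, h1, hk⟩⟩

/-- the first vertex outside `Z` on a path -/
theorem exists_exit {A : V → V → Prop} (Z : Set V) (u t : V) (ht : t ∉ Z)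
    (h : Relation.ReflTransGen A u t) :
    ∃ s, s ∉ Z ∧ Relation.ReflTransGen (fun p q => A p q ∧ p ∈ Z) u s := by
  induction h using Relation.ReflTransGen.head_induction_on with
  | refl => exact ⟨t, ht, .refl⟩
  | @head p q h1 _ ih =>
    by_cases hp : p ∈ Z
    · obtain ⟨s, hs, h3⟩ := ih
      exact ⟨s, hs, .head ⟨h1, hp⟩ h3⟩
    · exact ⟨p, hp, .refl⟩

theorem exit_avoid {A : V → V → Prop} (Z : Set V) (u s v : V) (hv : v ∉ Z) (hs : s ≠ v)
    (h : Relation.ReflTransGen (fun p q => A p q ∧ p ∈ Z) u s) :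
    Relation.ReflTransGen (fun p q => A p q ∧ p ≠ v ∧ q ≠ v) u s ∧ u ≠ v := by
  induction h using Relation.ReflTransGen.head_induction_on with
  | refl => exact ⟨.refl, hs⟩
  | @head p q h1 _ ih =>
    have hp : p ≠ v := by
      rintro rfl
      exact hv h1.2
    exact ⟨.head ⟨h1.1, hp, ih.2⟩ ih.1, hp⟩

/-- deletion of a vertex -/
def delV (A : V → V → Prop) (v : V) : {x // x ≠ v} → {x // x ≠ v} → Prop :=
  fun x y => A x.1 y.1

theorem rtg_sub {A : V → V → Prop} {v : V} (x y : V) (hy : y ≠ v)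
    (h : Relation.ReflTransGen (fun p q => A p q ∧ p ≠ v ∧ q ≠ v) x y) :
    ∃ hx : x ≠ v, Relation.ReflTransGen (delV A v) ⟨x, hx⟩ ⟨y, hy⟩ := by
  induction h using Relation.ReflTransGen.head_induction_on with
  | refl => exact ⟨hy, .refl⟩
  | @head p q h1 _ ih =>
    obtain ⟨hq, h3⟩ := ih
    exact ⟨h1.2.1, .head (show delV A v ⟨p, h1.2.1⟩ ⟨q, hq⟩ from h1.1) h3⟩

theorem reach_sub {A : V → V → Prop} {v : V} : ∀ k (x y : {x // x ≠ v}),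
    ReachWithin (delV A v) k x y → ReachWithin A k x.1 y.1 := by
  intro k
  induction k with
  | zero => intro x y h; exact congrArg Subtype.val h
  | succ k ih =>
    rintro x y (h | ⟨w, h1, h2⟩)
    · exact Or.inl (congrArg Subtype.val h)
    · exact Or.inr ⟨w.1, h1, ih w y h2⟩

theorem missAll_del [Fintype V] (A : V → V → Prop) (v : V) :
    missAll (delV A v) + (missOut A v + missIn A v) ≤ missAll A := by
  unfold missAll
  rw [Fintype.sum_eq_add_sum_subtype_ne (fun x => missOut A x) v]
  have h1 : ∀ x : {x // x ≠ v}, missOut A x.1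
      = (if MissArc A x.1 v then 1 else 0) + missOut (delV A v) x := by
    intro x
    unfold missOut
    rw [Fintype.sum_eq_add_sum_subtype_ne _ v]
    congr 1
    apply Finset.sum_congr rfl
    intro y _
    have hiff : MissArc A x.1 y.1 ↔ MissArc (delV A v) x y := by
      simp [MissArc, delV, Subtype.ext_iff]
    simp only [hiff]
  simp_rw [h1]
  rw [Finset.sum_add_distrib]
  have h2 : missIn A v = ∑ x : {x // x ≠ v}, (if MissArc A x.1 v then 1 else 0) := by
    unfold missIn
    rw [Fintype.sum_eq_add_sum_subtype_ne _ v]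
    simp [MissArc]
  rw [h2]
  omega

theorem sum_missIn [Fintype V] (A : V → V → Prop) : ∑ x, missIn A x = missAll A := by
  unfold missAll missIn missOut
  exact Finset.sum_comm

theorem exists_mid [Fintype V] {A : V → V → Prop} (hn : 100 ≤ Fintype.card V) (x y v : V)
    (hx : 4 * missOut A x ≤ Fintype.card V) (hy : 4 * missIn A y ≤ Fintype.card V) :
    ∃ c, c ≠ v ∧ A x c ∧ A c y := by
  by_contra hc
  push Not at hc
  have hsub : (univ : Finset V) ⊆ (univ.filter (fun z => MissArc A x z))
      ∪ (univ.filter (fun z => MissArc A z y)) ∪ {x, y, v} := by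
    intro c _
    simp only [mem_union, mem_filter, mem_univ, true_and, mem_insert, mem_singleton]
    by_cases h1 : c = x
    · simp [h1]
    by_cases h2 : c = y
    · simp [h2]
    by_cases h3 : c = v
    · simp [h3]
    left
    by_cases h4 : A x c
    · exact Or.inr ⟨h2, hc c h3 h4⟩
    · exact Or.inl ⟨fun h => h1 h.symm, h4⟩
  have e1 := Finset.card_le_card hsub
  have e2 := Finset.card_union_le ((univ.filter (fun z => MissArc A x z))
      ∪ (univ.filter (fun z => MissArc A z y))) {x, y, v}
  have e3 := Finset.card_union_le (univ.filter (fun z => MissArc A x z))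
      (univ.filter (fun z => MissArc A z y))
  have e4 : ({x, y, v} : Finset V).card ≤ 3 := Finset.card_le_three
  unfold missOut at hx
  unfold missIn at hy
  rw [← Finset.card_filter] at hx hy
  rw [card_univ] at e1
  omega

theorem exists_removable [Fintype V] {A : V → V → Prop} {r : ℕ} (hr : 4 ≤ r)
    (hirr : ∀ x, ¬ A x x)
    (hsc : StronglyConnected A) (hfar : ∀ v, ¬ outEccLe A (r - 1) v)
    (hn : 100 * r ≤ Fintype.card V)
    (hM : missAll A < (2 * r - 3) * Fintype.card V) :
    ∃ v, StronglyConnected (delV A v) ∧ ∀ x, ¬ outEccLe (delV A v) (r - 1) x := by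
  set n := Fintype.card V with hnd
  set Z : Finset V := univ.filter (fun x => n < 4 * missOut A x ∨ n < 4 * missIn A x) with hZ
  have hn100 : 100 ≤ n := by omega
  have hZc : Z.card * n ≤ 8 * missAll A := by
    calc Z.card * n = ∑ x ∈ Z, n := by simp
      _ ≤ ∑ x ∈ Z, (4 * missOut A x + 4 * missIn A x) := by
        apply Finset.sum_le_sum
        intro x hx
        simp only [hZ, mem_filter, mem_univ, true_and] at hx
        omega
      _ ≤ ∑ x, (4 * missOut A x + 4 * missIn A x) :=
        Finset.sum_le_sum_of_subset (Finset.subset_univ _)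
      _ = 8 * missAll A := by
        rw [Finset.sum_add_distrib, ← Finset.mul_sum, ← Finset.mul_sum, sum_missIn]
        unfold missAll
        ring
  have hZ2 : Z.card < 8 * (2 * r - 3) := by
    have : Z.card * n < 8 * (2 * r - 3) * n := by nlinarith
    exact lt_of_mul_lt_mul_right this (Nat.zero_le _)
  have hnZ : ∀ x, x ∉ Z → 4 * missOut A x ≤ n ∧ 4 * missIn A x ≤ n := by
    intro x hx
    simp only [hZ, mem_filter, mem_univ, true_and] at hx
    omega
  obtain ⟨t0, ht0⟩ : ∃ t, t ∉ Z := by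
    by_contra hc
    push Not at hc
    have : (univ : Finset V) ⊆ Z := fun x _ => hc x
    have := Finset.card_le_card this
    rw [card_univ] at this
    omega
  have hrtg : ∀ x y, Relation.ReflTransGen A x y := fun x y => (reach_iff_rtg x y).1 (hsc x y)
  have hex1 : ∀ x, ∃ s, s ∉ Z ∧ Relation.ReflTransGen (fun p q => A p q ∧ p ∈ Z) x s := by
    intro x
    simpa using exists_exit (Z : Set V) x t0 (by simpa using ht0) (hrtg x t0)
  have hex2 : ∀ x, ∃ s, s ∉ Z ∧
      Relation.ReflTransGen (fun p q => Function.swap A p q ∧ p ∈ Z) x s := by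
    intro x
    simpa using exists_exit (A := Function.swap A) (Z : Set V) x t0 (by simpa using ht0)
      (Relation.ReflTransGen.swap _ _ (hrtg t0 x))
  have hex3 : ∀ x, ∃ f, ¬ ReachWithin A (r-1) x f := by
    intro x
    have := hfar x
    unfold outEccLe at this
    push Not at this
    exact this
  choose s1 hs1 hs1' using hex1
  choose s2 hs2 hs2' using hex2
  choose f hf using hex3
  obtain ⟨v, hv⟩ : ∃ v, v ∉ Z ∪ Z.image s1 ∪ Z.image s2 ∪ Z.image f := by
    by_contra hc
    push Not at hc
    have : (univ : Finset V) ⊆ Z ∪ Z.image s1 ∪ Z.image s2 ∪ Z.image f := fun x _ => hc x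
    have e0 := Finset.card_le_card this
    rw [card_univ] at e0
    have e1 := Finset.card_union_le (Z ∪ Z.image s1 ∪ Z.image s2) (Z.image f)
    have e2 := Finset.card_union_le (Z ∪ Z.image s1) (Z.image s2)
    have e3 := Finset.card_union_le Z (Z.image s1)
    have e4 := Finset.card_image_le (s := Z) (f := s1)
    have e5 := Finset.card_image_le (s := Z) (f := s2)
    have e6 := Finset.card_image_le (s := Z) (f := f)
    omega
  simp only [mem_union, mem_image, not_or, not_exists, not_and] at hv
  obtain ⟨⟨⟨hvZ, hv1⟩, hv2⟩, hv3⟩ := hv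
  have hmid : ∀ x y, x ∉ Z → y ∉ Z → x ≠ v → y ≠ v →
      Relation.ReflTransGen (fun p q => A p q ∧ p ≠ v ∧ q ≠ v) x y := by
    intro x y hx hy hxv hyv
    obtain ⟨c, hc, h1, h2⟩ := exists_mid hn100 x y v (hnZ x hx).1 (hnZ y hy).2
    exact .head ⟨h1, hxv, hc⟩ (.single ⟨h2, hc, hyv⟩)
  have hout : ∀ x, x ≠ v → ∃ s, s ∉ Z ∧ s ≠ v ∧
      Relation.ReflTransGen (fun p q => A p q ∧ p ≠ v ∧ q ≠ v) x s := by
    intro x hx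
    by_cases hxZ : x ∈ Z
    · exact ⟨s1 x, hs1 x, hv1 x hxZ,
        (exit_avoid (Z : Set V) x (s1 x) v (by simpa using hvZ) (hv1 x hxZ)
          (by simpa using hs1' x)).1⟩
    · exact ⟨x, hxZ, hx, .refl⟩
  have hin : ∀ x, x ≠ v → ∃ s, s ∉ Z ∧ s ≠ v ∧
      Relation.ReflTransGen (fun p q => A p q ∧ p ≠ v ∧ q ≠ v) s x := by
    intro x hx
    by_cases hxZ : x ∈ Z
    · refine ⟨s2 x, hs2 x, hv2 x hxZ, ?_⟩
      have := (exit_avoid (A := Function.swap A) (Z : Set V) x (s2 x) v (by simpa using hvZ)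
        (hv2 x hxZ) (by simpa using hs2' x)).1
      have h3 := Relation.ReflTransGen.swap _ _ this
      refine Relation.ReflTransGen.mono ?_ _ _ h3
      rintro p q ⟨h4, h5, h6⟩
      exact ⟨h4, h6, h5⟩
    · exact ⟨x, hxZ, hx, .refl⟩
  refine ⟨v, ?_, ?_⟩
  · rintro ⟨x, hx⟩ ⟨y, hy⟩
    rw [reach_iff_rtg]
    obtain ⟨s, h1, h2, h3⟩ := hout x hx
    obtain ⟨t, h4, h5, h6⟩ := hin y hy
    obtain ⟨_, h⟩ := rtg_sub x y hy ((h3.trans (hmid s t h1 h4 h2 h5)).trans h6)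
    exact h
  · rintro ⟨x, hx⟩ hecc
    have hfv : f x ≠ v := by
      by_cases hxZ : x ∈ Z
      · exact hv3 x hxZ
      · intro hfx
        obtain ⟨c, hc, h1, h2⟩ := exists_mid hn100 x v v (hnZ x hxZ).1 (hnZ v hvZ).2
        apply hf x
        rw [hfx]
        exact reach_le (by omega) _ _
          (reach_trans 1 1 x c v (reach_arc _ _ h1) (reach_arc _ _ h2))
    exact hf x (reach_sub _ _ _ (hecc ⟨f x, hfv⟩))

theorem main_ind (r : ℕ) (hr : 4 ≤ r) : ∀ (k : ℕ) (V : Type) [Fintype V] (A : V → V → Prop),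
    Fintype.card V = 100 * r + k → (∀ x, ¬ A x x) → StronglyConnected A →
    (∀ v, ¬ outEccLe A (r - 1) v) →
    (2 * r - 3) * Fintype.card V ≤ missAll A + (r - 2) * (r + 1) ∨
      (2 * r - 2) * k ≤ missAll A := by
  intro k
  induction k with
  | zero => intro V _ A _ _ _ _; right; simp
  | succ k ih =>
    intro V _ A hc hirr hsc hfar
    by_cases hM : missAll A < (2 * r - 3) * Fintype.card V
    · obtain ⟨v, h1, h2⟩ := exists_removable hr hirr hsc hfar (by omega) hM
      obtain ⟨d, G⟩ := exists_goodDist hr hirr hsc hfar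
      by_cases ht : missOut A v + missIn A v = 2 * r - 3
      · left
        obtain ⟨a, b, S⟩ := G.exists_strands hr v ht
        apply S.total hr G
        have : missIn A v = 0 := by
          unfold missIn
          apply Finset.sum_eq_zero
          intro x _
          have := S.dom x
          rw [if_neg]
          rw [G.miss_iff]
          omega
        omega
      · have hge := G.deg_ge hr v
        have hdel := missAll_del A v
        have hcard : Fintype.card {x // x ≠ v} = 100 * r + k := by
          rw [Fintype.card_subtype_compl, Fintype.card_subtype_eq]
          omega
        rcases ih {x // x ≠ v} (delV A v) hcard (fun x => hirr x.1) h1 h2 with h | h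
        · left
          rw [hcard] at h
          rw [hc, ← add_assoc, mul_add, mul_one]
          omega
        · right
          rw [mul_add, mul_one]
          omega
    · left
      omega

theorem arc_add_miss [Fintype V] (A : V → V → Prop) (hirr : ∀ x, ¬ A x x) :
    arcCard A + missAll A + Fintype.card V = Fintype.card V * Fintype.card V := by
  have h1 : arcCard A = ∑ x, ∑ y, if A x y then 1 else 0 := by
    unfold arcCard
    rw [Set.ncard_eq_toFinset_card', ← Fintype.sum_prod_type', ← Finset.card_filter]
    congr 1
    ext p
    simp
  have h2 : Fintype.card V = ∑ x : V, ∑ y : V, if x = y then 1 else 0 := by simp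
  have h3 : Fintype.card V * Fintype.card V = ∑ x : V, ∑ y : V, 1 := by simp
  rw [h3]
  conv_lhs => rw [h1, h2]
  unfold missAll missOut
  rw [← Finset.sum_add_distrib, ← Finset.sum_add_distrib]
  apply Finset.sum_congr rfl
  intro x _
  rw [← Finset.sum_add_distrib, ← Finset.sum_add_distrib]
  apply Finset.sum_congr rfl
  intro y _
  by_cases hxy : x = y
  · subst hxy
    simp [MissArc, hirr]
  · by_cases hA : A x y <;> simp [MissArc, hxy, hA]

end MainProof

/-- For `r ≥ 4` there is `n₁(r)` such that every strongly connected digraph of order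
`n > n₁(r)` with out-radius `r` has at most `(n-(r-1))² + (r-3)` arcs. -/
theorem stmt15 (r : ℕ) (hr : 4 ≤ r) :
    ∃ n1 : ℕ, ∀ (V : Type) [inst : Fintype V], ∀ A : V → V → Prop,
      Irreflexive A → StronglyConnected A → outRadiusIs A r →
      n1 < Fintype.card V →
      arcCard A ≤ (Fintype.card V - (r - 1)) ^ 2 + (r - 3) := by

  refine ⟨(2 * r - 2) * (100 * r), ?_⟩
  intro V _ A hirr hsc hrad hn
  have hirr' : ∀ x, ¬ A x x := hirr
  have hbig : 100 * r ≤ Fintype.card V := by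
    have : 1 * (100 * r) ≤ (2 * r - 2) * (100 * r) := Nat.mul_le_mul_right _ (by omega)
    omega
  obtain ⟨k, hk⟩ := Nat.exists_eq_add_of_le hbig
  have hmain := main_ind r hr k V A hk hirr' hsc hrad.2
  have hcount := arc_add_miss A hirr'
  have hL : (2 * r - 3) * Fintype.card V ≤ missAll A + (r - 2) * (r + 1) := by
    rcases hmain with h | h
    · exact h
    · obtain ⟨m, rfl⟩ : ∃ m, r = m + 4 := ⟨r - 4, by omega⟩
      rw [show 2 * (m + 4) - 3 = 2 * m + 5 by omega]
      rw [show 2 * (m + 4) - 2 = 2 * m + 6 by omega] at h hn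
      nlinarith
  obtain ⟨m, rfl⟩ : ∃ m, r = m + 4 := ⟨r - 4, by omega⟩
  obtain ⟨q, hq⟩ : ∃ q, Fintype.card V = q + (m + 3) :=
    ⟨Fintype.card V - (m + 3), by omega⟩
  rw [show 2 * (m + 4) - 3 = 2 * m + 5 by omega, show m + 4 - 2 = m + 2 by omega] at hL
  rw [show Fintype.card V - (m + 4 - 1) = q by omega, show m + 4 - 3 = m + 1 by omega]
  rw [hq] at hL hcount
  nlinarith
end

section
/- Let G be a graph with radius r and n >= 2r >= 6 vertices. Then the number of edges of G is at most ((n-2r)^2 + 5n - 6r)/2. -/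
namespace Vizing

universe u

variable {V : Type u}

/-- `p 0, …, p H` is a geodesic starting at `v`. -/
structure Geo (G : SimpleGraph V) (v : V) (p : ℕ → V) (H : ℕ) : Prop where
  zero : p 0 = v
  adj : ∀ i, i < H → G.Adj (p i) (p (i + 1))
  dist : ∀ i, i ≤ H → G.dist v (p i) = i

/-- `k` is separated from `v` by `c`. -/
def Beh (G : SimpleGraph V) (v c k : V) : Prop :=
  k ≠ c ∧ ∀ p : G.Walk v k, c ∈ p.support

/-- `a` is the only vertex at distance at least `r` from `x`, and that distance is `r`. -/
def Star (G : SimpleGraph V) (r : ℕ) (a x : V) : Prop :=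
  G.dist x a = r ∧ ∀ w, w ≠ a → G.dist x w < r

variable {G : SimpleGraph V}

theorem exists_geo (hc : G.Connected) (v x : V) :
    ∃ p, Geo G v p (G.dist v x) ∧ p (G.dist v x) = x := by
  obtain ⟨w, hw⟩ := hc.exists_walk_length_eq_dist v x
  refine ⟨w.getVert, ⟨w.getVert_zero, ?_, ?_⟩, ?_⟩
  · intro i hi
    exact w.adj_getVert_succ (by omega)
  · have h1 : ∀ i, G.dist v (w.getVert i) ≤ i := by
      intro i
      have := SimpleGraph.dist_le (w.take i)
      have h2 : (w.take i).length ≤ i := by simp [SimpleGraph.Walk.take_length]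
      omega
    have h2 : ∀ i, G.dist (w.getVert i) x ≤ w.length - i := by
      intro i
      have := SimpleGraph.dist_le (w.drop i)
      simpa [SimpleGraph.Walk.drop_length] using this
    intro i hi
    have := hc.dist_triangle (u := v) (v := w.getVert i) (w := x)
    have := h1 i
    have := h2 i
    omega
  · rw [← hw]; exact w.getVert_length

theorem Geo.walk {v : V} {p : ℕ → V} {H : ℕ} (h : Geo G v p H) (i j : ℕ) (hij : i ≤ j)
    (hj : j ≤ H) : ∃ w : G.Walk (p i) (p j), w.length = j - i ∧
      ∀ x ∈ w.support, ∃ l, i ≤ l ∧ l ≤ j ∧ x = p l := by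
  induction j, hij using Nat.le_induction with
  | base =>
    refine ⟨.nil, by simp, ?_⟩
    intro x hx
    simp at hx
    exact ⟨i, le_rfl, le_rfl, hx⟩
  | succ j hij ih =>
    obtain ⟨w, hw, hs⟩ := ih (by omega)
    refine ⟨w.concat (h.adj j (by omega)), ?_, ?_⟩
    · rw [SimpleGraph.Walk.length_concat]; omega
    · intro x hx
      rw [SimpleGraph.Walk.support_concat] at hx
      simp at hx
      rcases hx with hx | hx
      · obtain ⟨l, h1, h2, h3⟩ := hs x hx
        exact ⟨l, h1, by omega, h3⟩
      · exact ⟨j + 1, by omega, le_rfl, hx⟩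

theorem Geo.dist_le {v : V} {p : ℕ → V} {H : ℕ} (h : Geo G v p H) (i j : ℕ) (hij : i ≤ j)
    (hj : j ≤ H) : G.dist (p i) (p j) ≤ j - i := by
  obtain ⟨w, hw, _⟩ := h.walk i j hij hj
  rw [← hw]; exact SimpleGraph.dist_le w

theorem Geo.eq_index {v : V} {p q : ℕ → V} {H K : ℕ} (h : Geo G v p H) (h' : Geo G v q K)
    {i j : ℕ} (hi : i ≤ H) (hj : j ≤ K) (e : p i = q j) : i = j := by
  rw [← h.dist i hi, e, h'.dist j hj]

theorem Beh.dist_eq (hc : G.Connected) {v c k w : V} (hk : Beh G v c k) (hwc : w ≠ c)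
    (hw : ¬ Beh G v c w) : G.dist k w = G.dist k c + G.dist c w := by
  classical
  have : ∃ p : G.Walk v w, c ∉ p.support := by
    by_contra hcon
    push Not at hcon
    exact hw ⟨hwc, hcon⟩
  obtain ⟨p, hp⟩ := this
  obtain ⟨q, hq⟩ := hc.exists_walk_length_eq_dist k w
  have hcq : c ∈ q.support := by
    have := hk.2 (p.append q.reverse)
    rw [SimpleGraph.Walk.mem_support_append_iff] at this
    rcases this with h | h
    · exact absurd h hp
    · simpa using h
  have h1 := SimpleGraph.dist_le (q.takeUntil c hcq)
  have h2 := SimpleGraph.dist_le (q.dropUntil c hcq)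
  have h3 : (q.takeUntil c hcq).length + (q.dropUntil c hcq).length = q.length := by
    rw [← SimpleGraph.Walk.length_append, SimpleGraph.Walk.take_spec]
  have := hc.dist_triangle (u := k) (v := c) (w := w)
  omega

theorem not_beh_of_adj {v c w : V} (h : G.Adj v w) (hv : v ≠ c) : ¬ Beh G v c w := by
  rintro ⟨h1, h2⟩
  have := h2 h.toWalk
  simp at this
  rcases this with h | h
  · exact hv h.symm
  · exact h1 h.symm

theorem not_beh_self {v c : V} (hv : v ≠ c) : ¬ Beh G v c v := by
  rintro ⟨h1, h2⟩
  have := h2 .nil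
  simp at this
  exact hv this.symm

/-- A geodesic through a vertex behind a neighbour `c` of `v` passes through `c` first. -/
theorem Geo.beh {v c : V} {p : ℕ → V} {H : ℕ} (h : Geo G v p H) (hvc : G.Adj v c) {i : ℕ}
    (hi : i ≤ H) (hb : Beh G v c (p i)) : c = p 1 ∧ 2 ≤ i := by
  obtain ⟨w, _, hs⟩ := h.walk 0 i (by omega) hi
  have h1 := hb.2 (w.copy h.zero rfl)
  simp at h1
  obtain ⟨l, _, hl, e⟩ := hs c h1
  have h2 := h.dist l (by omega)
  rw [← e, SimpleGraph.dist_eq_one_iff_adj.2 hvc] at h2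
  subst h2
  refine ⟨e, ?_⟩
  by_contra hcon
  have : i = 1 := by omega
  subst this
  exact hb.1 e.symm

theorem Geo.beh_all {v c : V} {p : ℕ → V} {H : ℕ} (h : Geo G v p H) (hvc : G.Adj v c) {i j : ℕ}
    (hi : i ≤ H) (hb : Beh G v c (p i)) (hj : j ≤ H) (hj2 : 2 ≤ j) : Beh G v c (p j) := by
  obtain ⟨e, hi2⟩ := h.beh hvc hi hb
  have hne : ∀ l, 2 ≤ l → l ≤ H → p l ≠ c := by
    intro l hl hlH hh
    rw [e] at hh
    have := h.eq_index h hlH (by omega) hh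
    omega
  have key : ∃ w : G.Walk (p j) (p i), c ∉ w.support := by
    rcases le_total i j with hij | hij
    · obtain ⟨w, _, hs⟩ := h.walk i j hij hj
      refine ⟨w.reverse, ?_⟩
      intro hcw
      simp at hcw
      obtain ⟨l, h1, h2, h3⟩ := hs c hcw
      exact hne l (by omega) (by omega) h3.symm
    · obtain ⟨w, _, hs⟩ := h.walk j i hij hi
      refine ⟨w, ?_⟩
      intro hcw
      obtain ⟨l, h1, h2, h3⟩ := hs c hcw
      exact hne l (by omega) (by omega) h3.symm
  obtain ⟨w, hw⟩ := key
  refine ⟨hne j hj2 hj, ?_⟩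
  intro q
  have := hb.2 (q.append w)
  rw [SimpleGraph.Walk.mem_support_append_iff] at this
  tauto

/-- Every connected graph of radius at least `r` has, for each `v`, two geodesics from `v` which
together contain `2r` vertices. -/
theorem exists_two_geo [Fintype V] [DecidableEq V] (hc : G.Connected) (r : ℕ) (hr : 1 ≤ r)
    (hrad : ∀ v, ∃ u, r ≤ G.dist v u) (v : V) :
    ∃ p H q K, Geo G v p H ∧ Geo G v q K ∧ 2 * r ≤
      ((Finset.range (H + 1)).image p ∪ (Finset.range (K + 1)).image q).card := by
  obtain ⟨x, -, hx⟩ := Finset.exists_max_image Finset.univ (G.dist v) ⟨v, Finset.mem_univ v⟩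
  obtain ⟨p, hp, hpx⟩ := exists_geo hc v x
  set H := G.dist v x with hH
  have hHr : r ≤ H := by
    obtain ⟨u, hu⟩ := hrad v
    exact hu.trans (hx u (Finset.mem_univ u))
  obtain ⟨y, hy⟩ := hrad (p (H - r + 1))
  obtain ⟨q, hq, hqy⟩ := exists_geo hc v y
  set K := G.dist v y with hK
  have hKH : K ≤ H := hx y (Finset.mem_univ y)
  refine ⟨p, H, q, K, hp, hq, ?_⟩
  let i := Nat.findGreatest (fun i => p i = q i) K
  have hi : p i = q i := Nat.findGreatest_spec (P := fun i => p i = q i) (m := 0) (by omega)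
    (by rw [hp.zero, hq.zero])
  have hiK : i ≤ K := Nat.findGreatest_le K
  have hmax : ∀ j, i < j → j ≤ K → p j ≠ q j := fun j hj hjK =>
    Nat.findGreatest_is_greatest hj hjK
  have h2 := hq.dist_le i K hiK le_rfl
  rw [hqy, ← hi] at h2
  have his : i < H - r + 1 := by
    by_contra hcon
    have h1 := hp.dist_le (H - r + 1) i (by omega) (by omega)
    have := hc.dist_triangle (u := p (H - r + 1)) (v := p i) (w := y)
    omega
  have h3 := hp.dist_le i (H - r + 1) (by omega) (by omega)
  have h4 := hc.dist_triangle (u := p (H - r + 1)) (v := p i) (w := y)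
  rw [SimpleGraph.dist_comm (u := p (H - r + 1)) (v := p i)] at h4
  have hsub : (Finset.Icc i H).image p ∪ (Finset.Ioc i K).image q ⊆
      (Finset.range (H + 1)).image p ∪ (Finset.range (K + 1)).image q := by
    apply Finset.union_subset_union
    · apply Finset.image_subset_image
      intro j hj
      simp at hj ⊢
      omega
    · apply Finset.image_subset_image
      intro j hj
      simp at hj ⊢
      omega
  refine le_trans ?_ (Finset.card_le_card hsub)
  rw [Finset.card_union_of_disjoint, Finset.card_image_of_injOn, Finset.card_image_of_injOn]
  · simp
    omega
  · intro a ha b hb hab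
    simp at ha hb
    exact hq.eq_index hq (by omega) (by omega) hab
  · intro a ha b hb hab
    simp at ha hb
    exact hp.eq_index hp (by omega) (by omega) hab
  · rw [Finset.disjoint_left]
    intro z hz hz'
    simp at hz hz'
    obtain ⟨a, ha, rfl⟩ := hz
    obtain ⟨b, hb, hab⟩ := hz'
    have := hp.eq_index hq (by omega) (by omega) hab.symm
    subst this
    exact hmax a (by omega) (by omega) hab.symm

theorem card_near [Fintype V] [DecidableEq V] {v : V} {p q : ℕ → V}
    {H K : ℕ} (hp : Geo G v p H) (hq : Geo G v q K) (N : Finset V)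
    (hN : ∀ x ∈ N, x = v ∨ G.Adj v x) :
    (((Finset.range (H + 1)).image p ∪ (Finset.range (K + 1)).image q) ∩ N).card ≤ 3 := by
  have : ((Finset.range (H + 1)).image p ∪ (Finset.range (K + 1)).image q) ∩ N ⊆
      {v, p 1, q 1} := by
    intro x hx
    simp only [Finset.mem_inter, Finset.mem_union, Finset.mem_image, Finset.mem_range] at hx
    obtain ⟨h1, h2⟩ := hx
    have hd : x = v ∨ G.dist v x = 1 := by
      rcases hN x h2 with h | h
      · exact Or.inl h
      · exact Or.inr (SimpleGraph.dist_eq_one_iff_adj.2 h)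
    simp only [Finset.mem_insert, Finset.mem_singleton]
    rcases hd with hd | hd
    · exact Or.inl hd
    rcases h1 with ⟨a, ha, rfl⟩ | ⟨a, ha, rfl⟩
    · rw [hp.dist a (by omega)] at hd
      subst hd; simp
    · rw [hq.dist a (by omega)] at hd
      subst hd; simp
  exact (Finset.card_le_card this).trans Finset.card_le_three

theorem degree_le [Fintype V] [DecidableEq V] [DecidableRel G.Adj] (hc : G.Connected) (r : ℕ)
    (hr : 1 ≤ r) (hrad : ∀ v, ∃ u, r ≤ G.dist v u) (v : V) :
    G.degree v + 2 * r ≤ Fintype.card V + 2 := by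
  obtain ⟨p, H, q, K, hp, hq, hcard⟩ := exists_two_geo hc r hr hrad v
  have h1 := card_near hp hq (insert v (G.neighborFinset v)) (by intro x hx; simpa using hx)
  set P := (Finset.range (H + 1)).image p ∪ (Finset.range (K + 1)).image q
  have h2 := Finset.card_union_add_card_inter P (insert v (G.neighborFinset v))
  have h3 := Finset.card_le_univ (P ∪ insert v (G.neighborFinset v))
  rw [Finset.card_insert_of_notMem (by simp), SimpleGraph.card_neighborFinset_eq_degree] at h2
  omega

theorem card_ge [Fintype V] (hc : G.Connected) (r : ℕ)
    (hr : 1 ≤ r) (hrad : ∀ v, ∃ u, r ≤ G.dist v u) :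
    2 * r ≤ Fintype.card V := by
  classical
  obtain ⟨v⟩ := hc.nonempty
  obtain ⟨p, H, q, K, hp, hq, hcard⟩ := exists_two_geo hc r hr hrad v
  exact hcard.trans (Finset.card_le_univ _)

/-- If `u` is behind `c` and has `e` as unique far vertex. -/
theorem special_aux (hc : G.Connected) {r : ℕ} {v c e u : V} (hvc : G.Adj v c)
    (hve : G.Adj v e) (hce : c ≠ e) (hb : Beh G v c u) (hs : Star G r e u) :
    G.dist c e = 2 ∧ ∀ w, w ≠ c → w ≠ e → ¬ Beh G v c w → G.dist c w ≤ 1 := by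
  have h1 := hb.dist_eq hc hvc.ne (not_beh_self hvc.ne)
  have h2 := hb.dist_eq hc hce.symm (not_beh_of_adj hve hvc.ne)
  have h3 := hs.2 v hve.ne
  have h4 := hs.1
  have h5 : G.dist c v = 1 := SimpleGraph.dist_eq_one_iff_adj.2 hvc.symm
  have h6 : G.dist v e = 1 := SimpleGraph.dist_eq_one_iff_adj.2 hve
  have h7 := hc.dist_triangle (u := c) (v := v) (w := e)
  refine ⟨by omega, ?_⟩
  intro w hwc hwe hw
  have h8 := hb.dist_eq hc hwc hw
  have h9 := hs.2 w hwe
  omega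

theorem special (hc : G.Connected) {r : ℕ} (hr : 3 ≤ r) {v c e u f t : V} (hvc : G.Adj v c)
    (hve : G.Adj v e) (hce : c ≠ e) (hb : Beh G v c u) (hs : Star G r e u)
    (hvf : G.Adj v f) (hfc : f ≠ c) (hfe : f ≠ e) (ht : Beh G v f t ∨ Star G r f t) : False := by
  obtain ⟨h1, h2⟩ := special_aux hc hvc hve hce hb hs
  have hf := h2 f hfc hfe (not_beh_of_adj hvf hvc.ne)
  rcases ht with ht | ht
  · have htc : ¬ Beh G v c t := by
      intro hh
      obtain ⟨p, hp, hpt⟩ := exists_geo hc v t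
      rw [← hpt] at hh ht
      exact hfc (((hp.beh hvf le_rfl ht).1).trans ((hp.beh hvc le_rfl hh).1).symm)
    have hnc : t ≠ c := by
      rintro rfl
      exact not_beh_of_adj hvc hvf.ne ht
    have hne : t ≠ e := by
      rintro rfl
      exact not_beh_of_adj hve hvf.ne ht
    have h3 := h2 t hnc hne htc
    have h4 := ht.dist_eq hc hfc.symm (not_beh_of_adj hvc hvf.ne)
    have h5 := hc.pos_dist_of_ne ht.1
    have h6 := hc.pos_dist_of_ne hfc
    rw [SimpleGraph.dist_comm] at h3
    omega
  · by_cases htc : Beh G v c t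
    · have h3 := (special_aux hc hvc hvf hfc.symm htc ht).1
      omega
    · have h3 := ht.1
      have h4 := hc.dist_triangle (u := t) (v := c) (w := f)
      rw [SimpleGraph.dist_comm (u := t) (v := c)] at h4
      by_cases hnc : t = c
      · subst hnc; omega
      by_cases hne : t = e
      · subst hne
        have h5 : G.dist t v = 1 := SimpleGraph.dist_eq_one_iff_adj.2 hve.symm
        have h6 : G.dist v f = 1 := SimpleGraph.dist_eq_one_iff_adj.2 hvf
        have h7 := hc.dist_triangle (u := t) (v := v) (w := f)
        omega
      have h5 := h2 t hnc hne htc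
      omega

theorem Star.unique {r : ℕ} {a b x : V} (ha : Star G r a x) (hb : Star G r b x) : a = b := by
  by_contra hne
  have h1 := hb.2 a hne
  have h2 := ha.1
  omega

theorem Star.layer (hc : G.Connected) {r : ℕ} {v a x : V} (hva : G.Adj v a)
    (ha : Star G r a x) : G.dist v x + 1 = r := by
  have h1 := ha.1
  have h2 := ha.2 v hva.ne
  have h6 : G.dist v a = 1 := SimpleGraph.dist_eq_one_iff_adj.2 hva
  have h7 := hc.dist_triangle (u := x) (v := v) (w := a)
  rw [SimpleGraph.dist_comm (u := x) (v := v)] at h7 h2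
  omega

theorem leg (hc : G.Connected) {r : ℕ} (hr : 3 ≤ r) {v : V}
    (hthird : ∀ a b, ∃ f t, G.Adj v f ∧ f ≠ a ∧ f ≠ b ∧ (Beh G v f t ∨ Star G r f t))
    {p : ℕ → V} {H : ℕ} (hp : Geo G v p H) {i j : ℕ} (hi : i ≤ H) (hj : j ≤ H) {a b : V}
    (ha : G.Adj v a) (hb : G.Adj v b) (hai : Beh G v a (p i) ∨ Star G r a (p i))
    (hbj : Beh G v b (p j) ∨ Star G r b (p j)) : a = b := by
  have mixed : ∀ {i j : ℕ} {a b : V}, i ≤ H → j ≤ H → G.Adj v a → G.Adj v b →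
      Beh G v a (p i) → Star G r b (p j) → a = b := by
    intro i j a b hi hj ha hb hai hbj
    by_contra hab
    have h1 := hbj.layer hc hb
    rw [hp.dist j hj] at h1
    have h2 := hp.beh_all ha hi hai hj (by omega)
    obtain ⟨f, t, hvf, hfa, hfb, ht⟩ := hthird a b
    exact special hc hr ha hb hab h2 hbj hvf hfa hfb ht
  rcases hai with hai | hai <;> rcases hbj with hbj | hbj
  · exact ((hp.beh ha hi hai).1).trans ((hp.beh hb hj hbj).1).symm
  · exact mixed hi hj ha hb hai hbj
  · exact (mixed hj hi hb ha hbj hai).symm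
  · have h1 := hbj.layer hc hb
    have h2 := hai.layer hc ha
    rw [hp.dist _ hj] at h1
    rw [hp.dist _ hi] at h2
    have : i = j := by omega
    subst this
    exact hai.unique hbj

theorem crit_degree [Fintype V] [DecidableEq V] [DecidableRel G.Adj] (hc : G.Connected) (r : ℕ)
    (hr : 3 ≤ r) (hrad : ∀ v, ∃ u, r ≤ G.dist v u)
    (hcrit : ∀ c v, v ≠ c → ∃ x, Beh G v c x ∨ Star G r c x) (v : V) :
    2 * G.degree v + 2 * r ≤ Fintype.card V + 4 := by
  have hcard0 := card_ge hc r (by omega) hrad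
  by_cases hdeg : G.degree v ≤ 2
  · omega
  have hthird : ∀ a b, ∃ f t, G.Adj v f ∧ f ≠ a ∧ f ≠ b ∧ (Beh G v f t ∨ Star G r f t) := by
    intro a b
    have : ∃ f ∈ G.neighborFinset v, f ∉ ({a, b} : Finset V) := by
      apply Finset.exists_mem_notMem_of_card_lt_card
      have := Finset.card_le_two (a := a) (b := b)
      rw [SimpleGraph.card_neighborFinset_eq_degree]
      omega
    obtain ⟨f, hf, hf'⟩ := this
    simp at hf hf'
    obtain ⟨t, ht⟩ := hcrit f v hf.ne
    exact ⟨f, t, hf, hf'.1, hf'.2, ht⟩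
  choose! x hx using fun (a : V) (h : v ≠ a) => hcrit a v h
  obtain ⟨p, H, q, K, hp, hq, hcard⟩ := exists_two_geo hc r (by omega) hrad v
  have h1 := card_near hp hq (insert v (G.neighborFinset v)) (by intro x hx; simpa using hx)
  set X := (G.neighborFinset v).image x with hX
  have hXcard : X.card = G.degree v := by
    rw [hX, Finset.card_image_of_injOn, SimpleGraph.card_neighborFinset_eq_degree]
    intro a ha b hb hab
    simp at ha hb
    obtain ⟨s, hs, hsa⟩ := exists_geo hc v (x a)
    have h2 := hx a ha.ne
    have h3 := hx b hb.ne
    rw [← hab] at h3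
    rw [← hsa] at h2 h3
    exact leg hc hr hthird hs le_rfl le_rfl ha hb h2 h3
  have hleg : ∀ (p : ℕ → V) (H : ℕ), Geo G v p H →
      (((Finset.range (H + 1)).image p) ∩ X).card ≤ 1 := by
    intro p H hp
    rw [Finset.card_le_one]
    intro y hy z hz
    simp [hX] at hy hz
    obtain ⟨⟨i, hi, rfl⟩, a, ha, hai⟩ := hy
    obtain ⟨⟨j, hj, rfl⟩, b, hb, hbj⟩ := hz
    have h2 := hx a ha.ne
    have h3 := hx b hb.ne
    rw [hai] at h2
    rw [hbj] at h3
    have := leg hc hr hthird hp (by omega) (by omega) ha hb h2 h3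
    rw [← hai, ← hbj, this]
  have hdisj : Disjoint (insert v (G.neighborFinset v)) X := by
    rw [Finset.disjoint_right]
    intro y hy hy'
    simp [hX] at hy hy'
    obtain ⟨a, ha, rfl⟩ := hy
    rcases hx a ha.ne with h | h
    · rcases hy' with h' | h'
      · rw [h'] at h; exact not_beh_self ha.ne h
      · exact not_beh_of_adj h' ha.ne h
    · have h2 := h.layer hc ha
      rcases hy' with h' | h'
      · rw [h', SimpleGraph.dist_self] at h2; omega
      · rw [SimpleGraph.dist_eq_one_iff_adj.2 h'] at h2; omega
  have hl1 := hleg p H hp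
  have hl2 := hleg q K hq
  set P := (Finset.range (H + 1)).image p
  set Q := (Finset.range (K + 1)).image q
  have h2 := Finset.card_union_add_card_inter (P ∪ Q) (insert v (G.neighborFinset v) ∪ X)
  have h3 := Finset.card_le_univ ((P ∪ Q) ∪ (insert v (G.neighborFinset v) ∪ X))
  have h4 : ((P ∪ Q) ∩ X).card ≤ 2 := by
    rw [Finset.union_inter_distrib_right]
    exact (Finset.card_union_le _ _).trans (by omega)
  rw [Finset.inter_union_distrib_left, Finset.card_union_of_disjoint hdisj,
    Finset.card_insert_of_notMem (by simp), SimpleGraph.card_neighborFinset_eq_degree] at h2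
  have h5 := Finset.card_union_le ((P ∪ Q) ∩ insert v (G.neighborFinset v)) ((P ∪ Q) ∩ X)
  omega

/-- A vertex with a unique far vertex yields an induced path on `2r - 1` vertices. -/
theorem exists_induced_path (hc : G.Connected) {r : ℕ} (hr : 3 ≤ r)
    (hrad : ∀ v, ∃ u, r ≤ G.dist v u) {x u : V} (hs : Star G r x u) :
    ∃ s : ℕ → V, (∀ i j, i < 2 * r - 1 → j < 2 * r - 1 → s i = s j → i = j) ∧
      (∀ i j, i < 2 * r - 1 → j < 2 * r - 1 → G.Adj (s i) (s j) → i = j + 1 ∨ j = i + 1) := by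
  obtain ⟨p, hp, hpx⟩ := exists_geo hc u x
  rw [hs.1] at hp hpx
  obtain ⟨z, hz⟩ := hrad (p 2)
  have hzx : z ≠ x := by
    rintro rfl
    have := hp.dist_le 2 r (by omega) le_rfl
    rw [hpx] at this
    omega
  have hzl := hs.2 z hzx
  obtain ⟨q, hq, hqz⟩ := exists_geo hc u z
  set L := G.dist u z with hL
  have hL2 : r ≤ L + 2 := by
    have h1 := hc.dist_triangle (u := p 2) (v := u) (w := z)
    have h2 := hp.dist 2 (by omega)
    rw [SimpleGraph.dist_comm] at h2
    omega
  have hlow : ∀ j, j ≤ L → r + j ≤ L + G.dist (p 2) (q j) := by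
    intro j hj
    have h1 := hc.dist_triangle (u := p 2) (v := q j) (w := z)
    have h2 := hq.dist_le j L hj le_rfl
    rw [hqz] at h2
    omega
  have hpp : ∀ i, i ≤ r → G.dist (p 2) (p i) ≤ (i - 2) + (2 - i) := by
    intro i hi
    rcases le_total 2 i with h | h
    · have := hp.dist_le 2 i h hi
      omega
    · have := hp.dist_le i 2 h (by omega)
      rw [SimpleGraph.dist_comm] at this
      omega
  have hlip : ∀ a b, G.Adj a b → ∀ w, G.dist w a ≤ G.dist w b + 1 := by
    intro a b hab w
    have h1 := hc.dist_triangle (u := w) (v := b) (w := a)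
    rw [SimpleGraph.dist_eq_one_iff_adj.2 hab.symm] at h1
    exact h1
  -- coincidences and adjacencies between the two geodesics
  have hne : ∀ i j, i ≤ r → j ≤ L → 1 ≤ j → p i ≠ q j := by
    intro i j hi hj hj1 e
    have := hp.eq_index hq hi hj e
    subst this
    have h1 := hlow i hj
    have h2 := hpp i hi
    rw [← e] at h1
    omega
  have hadj : ∀ i j, i ≤ r → j ≤ L → 1 ≤ j → G.Adj (p i) (q j) →
      (i = 0 ∧ j = 1) ∨ (i = 1 ∧ j = 1 ∧ L + 1 = r) := by
    intro i j hi hj hj1 e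
    have h1 := hlow j hj
    have h2 := hpp i hi
    have h3 := hlip _ _ e.symm (p 2)
    have h4 := hlip _ _ e u
    have h5 := hlip _ _ e.symm u
    rw [hp.dist i hi, hq.dist j hj] at h4 h5
    omega
  have hself : ∀ {t : ℕ → V} {M : ℕ}, Geo G u t M → ∀ i j, i ≤ M → j ≤ M → G.Adj (t i) (t j) →
      i = j + 1 ∨ j = i + 1 := by
    intro t M ht i j hi hj e
    have h4 := hlip _ _ e u
    have h5 := hlip _ _ e.symm u
    rw [ht.dist i hi, ht.dist j hj] at h4 h5
    have : i ≠ j := by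
      rintro rfl
      exact e.ne rfl
    omega
  by_cases h11 : G.Adj (p 1) (q 1)
  · have hLr : L + 1 = r := by
      have := hadj 1 1 (by omega) (by omega) le_rfl h11
      omega
    refine ⟨fun i => if i < r - 1 then q (r - 1 - i) else p (i + 2 - r), ?_, ?_⟩
    · intro i j hi hj e
      dsimp only at e
      split_ifs at e with hi' hj' hj'
      · have := hq.eq_index hq (by omega) (by omega) e
        omega
      · exact absurd e.symm (hne _ _ (by omega) (by omega) (by omega))
      · exact absurd e (hne _ _ (by omega) (by omega) (by omega))
      · have := hp.eq_index hp (by omega) (by omega) e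
        omega
    · intro i j hi hj e
      dsimp only at e
      split_ifs at e with hi' hj' hj'
      · have := hself hq _ _ (by omega) (by omega) e
        omega
      · have := hadj _ _ (by omega) (by omega) (by omega) e.symm
        omega
      · have := hadj _ _ (by omega) (by omega) (by omega) e
        omega
      · have := hself hp _ _ (by omega) (by omega) e
        omega
  · have hadj' : ∀ i j, i ≤ r → j ≤ L → 1 ≤ j → G.Adj (p i) (q j) → (i = 0 ∧ j = 1) := by
      intro i j hi hj hj1 e
      rcases hadj i j hi hj hj1 e with h | ⟨rfl, rfl, _⟩
      · exact h
      · exact absurd e h11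
    refine ⟨fun i => if i < r - 2 then q (r - 2 - i) else p (i + 2 - r), ?_, ?_⟩
    · intro i j hi hj e
      dsimp only at e
      split_ifs at e with hi' hj' hj'
      · have := hq.eq_index hq (by omega) (by omega) e
        omega
      · exact absurd e.symm (hne _ _ (by omega) (by omega) (by omega))
      · exact absurd e (hne _ _ (by omega) (by omega) (by omega))
      · have := hp.eq_index hp (by omega) (by omega) e
        omega
    · intro i j hi hj e
      dsimp only at e
      split_ifs at e with hi' hj' hj'
      · have := hself hq _ _ (by omega) (by omega) e
        omega
      · have := hadj' _ _ (by omega) (by omega) (by omega) e.symm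
        omega
      · have := hadj' _ _ (by omega) (by omega) (by omega) e
        omega
      · have := hself hp _ _ (by omega) (by omega) e
        omega

/-- Counting edges when there is an induced path and the degrees outside of it are small. -/
theorem count [Fintype V] [DecidableEq V] [DecidableRel G.Adj] (k d : ℕ) (s : ℕ → V)
    (hinj : ∀ i j, i < k + 1 → j < k + 1 → s i = s j → i = j)
    (hadj : ∀ i j, i < k + 1 → j < k + 1 → G.Adj (s i) (s j) → i = j + 1 ∨ j = i + 1)
    (hdeg : ∀ v, 2 * G.degree v ≤ d) :
    2 * G.edgeFinset.card + d * (k + 1) ≤ 2 * k + Fintype.card V * d := by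
  set S := (Finset.range (k + 1)).image s with hS
  have hScard : S.card = k + 1 := by
    rw [hS, Finset.card_image_of_injOn, Finset.card_range]
    intro i hi j hj e
    simp at hi hj
    exact hinj i j (by omega) (by omega) e
  have hsum := G.sum_degrees_eq_twice_card_edges
  have hsplit : ∀ v, G.degree v = (S.filter (fun w => G.Adj v w)).card +
      (Sᶜ.filter (fun w => G.Adj v w)).card := by
    intro v
    rw [← SimpleGraph.card_neighborFinset_eq_degree, SimpleGraph.neighborFinset_eq_filter,
      ← Finset.card_union_of_disjoint, ← Finset.filter_union, Finset.union_compl]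
    exact (disjoint_compl_right).mono (Finset.filter_subset _ _) (Finset.filter_subset _ _)
  have hSC : S.card + Sᶜ.card = Fintype.card V := Finset.card_add_card_compl S
  have hout : 2 * ∑ v ∈ Sᶜ, G.degree v ≤ Sᶜ.card * d := by
    rw [Finset.mul_sum]
    simpa using Finset.sum_le_card_nsmul Sᶜ (fun v => 2 * G.degree v) d (fun v _ => hdeg v)
  have hcross : ∑ v ∈ S, (Sᶜ.filter (fun w => G.Adj v w)).card ≤ ∑ v ∈ Sᶜ, G.degree v := by
    have := Finset.sum_card_bipartiteAbove_eq_sum_card_bipartiteBelow (s := S) (t := Sᶜ) G.Adj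
    simp only [Finset.bipartiteAbove, Finset.bipartiteBelow] at this
    rw [this]
    apply Finset.sum_le_sum
    intro v _
    rw [hsplit v]
    have : (S.filter (fun a => G.Adj a v)) = (S.filter (fun w => G.Adj v w)) := by
      ext w; simp [G.adj_comm]
    rw [this]
    omega
  have hin : ∑ v ∈ S, (S.filter (fun w => G.Adj v w)).card ≤ 2 * k := by
    rw [← Finset.card_sigma]
    have hsub : (S.sigma fun v => S.filter (fun w => G.Adj v w)) ⊆
        ((Finset.range k).image fun i => (⟨s i, s (i + 1)⟩ : Σ _ : V, V)) ∪
        ((Finset.range k).image fun i => (⟨s (i + 1), s i⟩ : Σ _ : V, V)) := by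
      rintro ⟨a, b⟩ hab
      simp only [hS, Finset.mem_sigma, Finset.mem_filter, Finset.mem_image, Finset.mem_range]
        at hab
      obtain ⟨⟨i, hi, rfl⟩, ⟨j, hj, rfl⟩, e⟩ := hab
      rw [Finset.mem_union]
      rcases hadj i j hi hj e with rfl | rfl
      · right
        exact Finset.mem_image.2 ⟨j, by simp; omega, rfl⟩
      · left
        exact Finset.mem_image.2 ⟨i, by simp; omega, rfl⟩
    have h1 := Finset.card_le_card hsub
    have h2 := Finset.card_union_le
      ((Finset.range k).image fun i => (⟨s i, s (i + 1)⟩ : Σ _ : V, V))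
      ((Finset.range k).image fun i => (⟨s (i + 1), s i⟩ : Σ _ : V, V))
    have h3 := Finset.card_image_le (s := Finset.range k)
      (f := fun i => (⟨s i, s (i + 1)⟩ : Σ _ : V, V))
    have h4 := Finset.card_image_le (s := Finset.range k)
      (f := fun i => (⟨s (i + 1), s i⟩ : Σ _ : V, V))
    rw [Finset.card_range] at h3 h4
    omega
  have hS2 : ∑ v ∈ S, G.degree v = ∑ v ∈ S, (S.filter (fun w => G.Adj v w)).card +
      ∑ v ∈ S, (Sᶜ.filter (fun w => G.Adj v w)).card := by
    rw [← Finset.sum_add_distrib]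
    exact Finset.sum_congr rfl fun v _ => hsplit v
  have htot : ∑ v ∈ S, G.degree v + ∑ v ∈ Sᶜ, G.degree v = ∑ v, G.degree v :=
    Finset.sum_add_sum_compl S _
  have : Fintype.card V * d = (k + 1) * d + Sᶜ.card * d := by
    rw [← hSC, hScard]; ring
  rw [this, mul_comm d]
  omega

/-- Failure of deletability of `c`. -/
theorem crit_of_not_removable (hc : G.Connected) {r : ℕ} (hr : 1 ≤ r)
    (hrad : ∀ v, ∃ u, r ≤ G.dist v u) (c : V)
    (h : ¬ ((G.induce {c}ᶜ).Connected ∧ ∀ v, ∃ u, r ≤ (G.induce {c}ᶜ).dist v u)) :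
    ((G.induce {c}ᶜ).Connected → ∃ x, Star G r c x) ∧
      ∀ v, v ≠ c → ∃ x, Beh G v c x ∨ Star G r c x := by
  have h1 : (G.induce {c}ᶜ).Connected → ∃ x, Star G r c x := by
    intro hcon
    have h2 : ¬ ∀ v, ∃ u, r ≤ (G.induce {c}ᶜ).dist v u := fun h3 => h ⟨hcon, h3⟩
    push Not at h2
    obtain ⟨u, hu⟩ := h2
    have h3 : ∀ w, w ≠ c → G.dist u w < r := by
      intro w hw
      obtain ⟨q, hq⟩ := hcon.exists_walk_length_eq_dist u ⟨w, hw⟩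
      have h4 := SimpleGraph.dist_le (q.map (SimpleGraph.Embedding.induce ({c}ᶜ : Set V)).toHom)
      rw [SimpleGraph.Walk.length_map, hq] at h4
      exact lt_of_le_of_lt h4 (hu ⟨w, hw⟩)
    have h4 : r ≤ G.dist u c := by
      obtain ⟨w, hw⟩ := hrad u
      by_cases hwc : w = c
      · rw [hwc] at hw
        exact hw
      · have := h3 w hwc
        omega
    refine ⟨u, ?_, h3⟩
    obtain ⟨p, hp, hpc⟩ := exists_geo hc (u : V) c
    have h5 := hp.dist (G.dist u c - 1) (by omega)
    have h6 := hp.adj (G.dist u c - 1) (by omega)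
    have h7 := h3 (p (G.dist u c - 1)) (by
      intro hh
      rw [hh] at h5
      omega)
    omega
  refine ⟨h1, ?_⟩
  intro v hv
  by_cases hcon : (G.induce {c}ᶜ).Connected
  · obtain ⟨x, hx⟩ := h1 hcon
    exact ⟨x, Or.inr hx⟩
  · by_contra hno
    push Not at hno
    apply hcon
    have hreach : ∀ k : ({c}ᶜ : Set V), (G.induce {c}ᶜ).Reachable ⟨v, hv⟩ k := by
      rintro ⟨k, hk⟩
      have hnb := (hno k).1
      have : ∃ p : G.Walk v k, c ∉ p.support := by
        by_contra hcon'
        push Not at hcon'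
        exact hnb ⟨hk, hcon'⟩
      obtain ⟨p, hp⟩ := this
      exact ⟨p.induce (s := {c}ᶜ) (by
        intro x hx hxc
        rw [Set.mem_singleton_iff] at hxc
        rw [hxc] at hx
        exact hp hx)⟩
    have : Nonempty ({c}ᶜ : Set V) := ⟨⟨v, hv⟩⟩
    exact ⟨fun a b => (hreach a).symm.trans (hreach b)⟩

theorem crit_bound [Fintype V] [DecidableEq V] [DecidableRel G.Adj] (r : ℕ) (hr : 3 ≤ r) (m : ℕ)
    (hc : G.Connected) (hrad : ∀ v, ∃ u, r ≤ G.dist v u) (hcard : Fintype.card V = 2 * r + m)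
    (hrem : ¬ ∃ c, (G.induce {c}ᶜ).Connected ∧ ∀ v, ∃ u, r ≤ (G.induce {c}ᶜ).dist v u) :
    2 * G.edgeFinset.card ≤ m ^ 2 + 5 * m + 4 * r := by
  push Not at hrem
  have hcr := fun c => crit_of_not_removable hc (by omega) hrad c (by
    rintro ⟨h1, h2⟩
    obtain ⟨v, hv⟩ := hrem c h1
    obtain ⟨w, hw⟩ := h2 v
    have := hv w
    omega)
  have : Nontrivial V := Fintype.one_lt_card_iff_nontrivial.1 (by omega)
  obtain ⟨x, hx⟩ := hc.exists_connected_induce_compl_singleton_of_finite_nontrivial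
  obtain ⟨y, hy⟩ := (hcr x).1 hx
  obtain ⟨s, h1, h2⟩ := exists_induced_path hc hr hrad hy
  have hdeg := crit_degree hc r hr hrad (fun c => (hcr c).2)
  obtain ⟨k, rfl⟩ : ∃ k, r = k + 1 := ⟨r - 1, by omega⟩
  have e : 2 * (k + 1) - 1 = 2 * k + 1 := by omega
  rw [e] at h1 h2
  have := count (2 * k) (m + 4) s h1 h2 (fun v => by
    have := hdeg v
    omega)
  rw [hcard] at this
  nlinarith

theorem main (r : ℕ) (hr : 3 ≤ r) (m : ℕ) : ∀ (V : Type u) [Fintype V] [DecidableEq V]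
    (G : SimpleGraph V) [DecidableRel G.Adj], G.Connected → (∀ v, ∃ u, r ≤ G.dist v u) →
    Fintype.card V = 2 * r + m → 2 * G.edgeFinset.card ≤ m ^ 2 + 5 * m + 4 * r := by
  induction m with
  | zero =>
    intro V _ _ G _ hc hrad hcard
    by_cases hrem : ∃ c, (G.induce {c}ᶜ).Connected ∧ ∀ v, ∃ u, r ≤ (G.induce {c}ᶜ).dist v u
    · obtain ⟨c, h1, h2⟩ := hrem
      have h3 := card_ge h1 r (by omega) h2
      have h4 : Fintype.card ({c}ᶜ : Set V) = Fintype.card V - 1 := by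
        rw [Fintype.card_compl_set]; simp
      omega
    · exact crit_bound r hr 0 hc hrad hcard hrem
  | succ m ih =>
    intro V _ _ G _ hc hrad hcard
    by_cases hrem : ∃ c, (G.induce {c}ᶜ).Connected ∧ ∀ v, ∃ u, r ≤ (G.induce {c}ᶜ).dist v u
    · obtain ⟨c, h1, h2⟩ := hrem
      have h4 : Fintype.card ({c}ᶜ : Set V) = Fintype.card V - 1 := by
        rw [Fintype.card_compl_set]; simp
      have h5 := ih _ (G.induce {c}ᶜ) h1 h2 (by omega)
      have h6 := G.card_edgeFinset_induce_compl_singleton c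
      have h7 := G.card_edgeFinset_deleteIncidenceSet c
      have h8 := degree_le hc r (by omega) hrad c
      have h9 : (G.induce {c}ᶜ).edgeFinset.card = G.edgeFinset.card - G.degree c := by
        rw [← h7, ← h6]
      have h10 : 2 * (G.edgeFinset.card - G.degree c) ≤ m ^ 2 + 5 * m + 4 * r := by
        rw [← h9]; exact h5
      have h11 : (m + 1) ^ 2 = m ^ 2 + 2 * m + 1 := by ring
      omega
    · exact crit_bound r hr (m + 1) hc hrad hcard hrem

end Vizing

/-- Vizing's theorem: a connected graph of radius `r` with `n ≥ 2r ≥ 6` vertices has at most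
`((n-2r)² + 5n - 6r)/2` edges. -/
theorem stmt17 {V : Type*} [Fintype V] (G : SimpleGraph V) (hconn : G.Connected)
    (r : ℕ) (hr : 3 ≤ r) (hn : 2 * r ≤ Fintype.card V)
    (hradLe : ∃ v, ∀ u, G.dist v u ≤ r) (hradGe : ∀ v, ∃ u, r ≤ G.dist v u) :
    2 * G.edgeSet.ncard ≤ (Fintype.card V - 2 * r) ^ 2 + 5 * Fintype.card V - 6 * r := by
  classical
  have h := Vizing.main r hr (Fintype.card V - 2 * r) V G hconn hradGe (by omega)
  have e : G.edgeSet.ncard = G.edgeFinset.card := by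
    rw [← SimpleGraph.coe_edgeFinset, Set.ncard_coe_finset]
  rw [e]
  generalize (Fintype.card V - 2 * r) ^ 2 = z at h ⊢
  omega
end
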